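/- Let b be a rational function in the closed unit ball of H∞ with ‖b‖∞ = 1 that is not a finite Blaschke product. Let φ ∈ H(b) ∩ ball(H∞) with φ(ξ_j) ∈ Z_T(a) for 1 ≤ j ≤ p and φ(ξ_j) ∈ D for p+1 ≤ j ≤ n, and let u = (a₁ ∘ φ) · ∏_{j=p+1}^n (φ − φ(ξ_j))^{m_j} / a₁. Then C_φ : H(b) → H(b) is compact (respectively Hilbert–Schmidt) if and only if the weighted composition operator W_{u,φ} : H² → H², W_{u,φ}(f) = u·(f ∘ φ), is compact (respectively Hilbert–Schmidt). -/

import Mathlib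

open Complex MeasureTheory Set Filter

noncomputable section

attribute [local instance] Classical.propDecidable

/-- The open unit disk in `ℂ`. -/
def unitDisk : Set ℂ := Metric.ball 0 1

/-- The unit circle in `ℂ`. -/
def unitCircle : Set ℂ := Metric.sphere 0 1

/-- Membership in `H^∞`: analytic and bounded on the unit disk. -/
def MemHinf (f : ℂ → ℂ) : Prop :=
  DifferentiableOn ℂ f unitDisk ∧ ∃ C : ℝ, ∀ z ∈ unitDisk, ‖f z‖ ≤ C

/-- Membership in the closed unit ball of `H^∞`. -/
def MemBallHinf (f : ℂ → ℂ) : Prop :=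
  DifferentiableOn ℂ f unitDisk ∧ ∀ z ∈ unitDisk, ‖f z‖ ≤ 1

/-- `f` agrees on the closed unit disk with a rational function without poles there. -/
def IsRationalOnDisk (f : ℂ → ℂ) : Prop :=
  ∃ P Q : Polynomial ℂ, ∀ z ∈ Metric.closedBall (0:ℂ) 1,
    Q.eval z ≠ 0 ∧ f z = P.eval z / Q.eval z

/-- `f` is a finite Blaschke product (multiplicities are encoded by repetition). -/
def IsFiniteBlaschke (f : ℂ → ℂ) : Prop :=
  ∃ (γ : ℂ) (k : ℕ) (lam : Fin k → ℂ), ‖γ‖ = 1 ∧ (∀ i, lam i ∈ unitDisk) ∧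
    ∀ z ∈ unitDisk, f z = γ * ∏ i, (z - lam i) / (1 - (starRingEnd ℂ) (lam i) * z)

/-- The `k`-th Taylor coefficient of `f` at the origin. -/
def taylorCoeff (f : ℂ → ℂ) (k : ℕ) : ℂ := iteratedDeriv k f 0 / k.factorial

/-- Membership in the Hardy space `H²` (square-summable Taylor coefficients). -/
def MemH2 (f : ℂ → ℂ) : Prop :=
  DifferentiableOn ℂ f unitDisk ∧ Summable fun k => ‖taylorCoeff f k‖ ^ 2

/-- The squared `H²` norm. -/
def h2NormSq (f : ℂ → ℂ) : ℝ := ∑' k, ‖taylorCoeff f k‖ ^ 2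

/-- The `H²` inner product. -/
def h2Inner (f g : ℂ → ℂ) : ℂ :=
  ∑' k, (starRingEnd ℂ) (taylorCoeff f k) * taylorCoeff g k

/-- The polynomial `a₁(z) = ∏ⱼ (z − ξⱼ)^{mⱼ}`. -/
def a1fun {n : ℕ} (ξ : Fin n → ℂ) (m : Fin n → ℕ) : ℂ → ℂ :=
  fun z => ∏ j, (z - ξ j) ^ (m j)

/-- A decomposition `f = a₁ g + q` with `g ∈ H²`, `deg q ≤ N − 1`, witnessing membership
in `H(b) = a₁H² ⊕ P_{N−1}`. -/
def HbDecompOf {n : ℕ} (ξ : Fin n → ℂ) (m : Fin n → ℕ)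
    (f g : ℂ → ℂ) (q : Polynomial ℂ) : Prop :=
  MemH2 g ∧ q.degree < ((∑ j, m j : ℕ) : WithBot ℕ) ∧
    ∀ z ∈ unitDisk, f z = a1fun ξ m z * g z + q.eval z

/-- Membership in `H(b) = a₁ H² ⊕ P_{N−1}` (description of `H(b)` for `b` rational,
not a finite Blaschke product, whose pythagorean mate has boundary zeros `ξ` with
multiplicities `m`). -/
def MemHb {n : ℕ} (ξ : Fin n → ℂ) (m : Fin n → ℕ) (f : ℂ → ℂ) : Prop :=
  ∃ gq : (ℂ → ℂ) × Polynomial ℂ, HbDecompOf ξ m f gq.1 gq.2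

/-- The (unique) decomposition of a member of `H(b)`. -/
def hbDecomp {n : ℕ} (ξ : Fin n → ℂ) (m : Fin n → ℕ) (f : ℂ → ℂ) :
    (ℂ → ℂ) × Polynomial ℂ :=
  if h : MemHb ξ m f then h.choose else (0, 0)

/-- The squared norm `⦀a₁g + q⦀² = ‖g‖²_{H²} + ‖q‖²_{H²}` on `H(b)`. -/
def hbNormSq {n : ℕ} (ξ : Fin n → ℂ) (m : Fin n → ℕ) (f : ℂ → ℂ) : ℝ :=
  h2NormSq (hbDecomp ξ m f).1 + h2NormSq fun z => ((hbDecomp ξ m f).2).eval z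

/-- The inner product on `H(b)` induced by the decomposition. -/
def hbInner {n : ℕ} (ξ : Fin n → ℂ) (m : Fin n → ℕ) (f g : ℂ → ℂ) : ℂ :=
  h2Inner (hbDecomp ξ m f).1 (hbDecomp ξ m g).1 +
    h2Inner (fun z => ((hbDecomp ξ m f).2).eval z)
      (fun z => ((hbDecomp ξ m g).2).eval z)

/-- The Stolz angle (non-tangential approach region) at a boundary point `ξ`. -/
def stolzAngle (ξ : ℂ) (M : ℝ) : Set ℂ := {z ∈ unitDisk | ‖z - ξ‖ ≤ M * (1 - ‖z‖)}

/-- `f` has non-tangential limit `L` at `ξ`. -/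
def NTLimit (f : ℂ → ℂ) (ξ L : ℂ) : Prop :=
  ∀ M : ℝ, 1 < M → Tendsto f (nhdsWithin ξ (stolzAngle ξ M)) (nhds L)

/-- Radial boundary value of `f` at `ζ` (junk value if the radial limit does not exist). -/
def bdryVal (f : ℂ → ℂ) (ζ : ℂ) : ℂ :=
  limUnder (nhdsWithin (1:ℝ) (Set.Iio 1)) fun r : ℝ => f ((r : ℂ) * ζ)

/-- The full setting: `b` is a rational function in the closed unit ball of `H^∞` with
`‖b‖_∞ = 1` which is not a finite Blaschke product; `a` is its pythagorean mate (rational,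
outer — i.e. zero-free on the disk —, `a(0) > 0`, `|a|² + |b|² = 1` on the circle); the
`ξ j` are the distinct zeros of `a` on the unit circle, with multiplicities `m j`. -/
structure RationalSetting (b a : ℂ → ℂ) (n : ℕ) (ξ : Fin n → ℂ) (m : Fin n → ℕ) :
    Prop where
  b_diff : DifferentiableOn ℂ b unitDisk
  b_rat : IsRationalOnDisk b
  b_le_one : ∀ z ∈ unitDisk, ‖b z‖ ≤ 1
  b_norm_one : sSup ((fun z => ‖b z‖) '' unitDisk) = 1
  b_not_fbp : ¬ IsFiniteBlaschke b
  a_diff : DifferentiableOn ℂ a unitDisk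
  a_rat : IsRationalOnDisk a
  a_outer : ∀ z ∈ unitDisk, a z ≠ 0
  a_zero_pos : 0 < (a 0).re ∧ (a 0).im = 0
  pyth : ∀ ζ ∈ unitCircle, ‖a ζ‖ ^ 2 + ‖b ζ‖ ^ 2 = 1
  zeros_mem : ∀ j, ξ j ∈ unitCircle
  zeros_inj : Function.Injective ξ
  mult_pos : ∀ j, 0 < m j
  factor : ∃ g : ℂ → ℂ, IsRationalOnDisk g ∧ (∀ ζ ∈ unitCircle, g ζ ≠ 0) ∧
    ∀ z ∈ Metric.closedBall (0:ℂ) 1, a z = a1fun ξ m z * g z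

/-- The composition operator `C_φ` maps `H(b)` into itself and is bounded there
(with respect to the equivalent norm `⦀·⦀_b`). -/
def CompBddHb {n : ℕ} (ξ : Fin n → ℂ) (m : Fin n → ℕ) (φ : ℂ → ℂ) : Prop :=
  (∀ f, MemHb ξ m f → MemHb ξ m fun z => f (φ z)) ∧
  ∃ C : ℝ, ∀ f, MemHb ξ m f →
    hbNormSq ξ m (fun z => f (φ z)) ≤ C * hbNormSq ξ m f

/-- The composition operator `C_φ` is compact on `H(b)`: it is bounded and the image of
every sequence in the unit ball has a subsequence whose image converges in `H(b)`. -/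
def CompCompactHb {n : ℕ} (ξ : Fin n → ℂ) (m : Fin n → ℕ) (φ : ℂ → ℂ) : Prop :=
  CompBddHb ξ m φ ∧
  ∀ f : ℕ → ℂ → ℂ, (∀ k, MemHb ξ m (f k) ∧ hbNormSq ξ m (f k) ≤ 1) →
    ∃ (κ : ℕ → ℕ) (g : ℂ → ℂ), StrictMono κ ∧ MemHb ξ m g ∧
      Tendsto (fun i => hbNormSq ξ m fun z => f (κ i) (φ z) - g z) atTop (nhds 0)

/-- The composition operator `C_φ` is Hilbert–Schmidt on `H(b)`: it is bounded and the sum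
of `⦀C_φ e⦀²` over the orthonormal basis `{a₁ z^k}ₖ ∪ {z^j}_{j<N}` of
`(H(b), ⦀·⦀_b)` is finite (the finite part of the sum being automatically finite). -/
def CompHSHb {n : ℕ} (ξ : Fin n → ℂ) (m : Fin n → ℕ) (φ : ℂ → ℂ) : Prop :=
  CompBddHb ξ m φ ∧
  Summable fun k : ℕ => hbNormSq ξ m fun z => a1fun ξ m (φ z) * φ z ^ k

/-- The weighted composition operator `W_{u,φ} f = u · (f ∘ φ)` maps `H²` boundedly
into itself. -/
def WCompBddH2 (u φ : ℂ → ℂ) : Prop :=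
  (∀ f, MemH2 f → MemH2 fun z => u z * f (φ z)) ∧
  ∃ C : ℝ, ∀ f, MemH2 f →
    h2NormSq (fun z => u z * f (φ z)) ≤ C * h2NormSq f

/-- The weighted composition operator `W_{u,φ}` is compact on `H²`. -/
def WCompCompactH2 (u φ : ℂ → ℂ) : Prop :=
  WCompBddH2 u φ ∧
  ∀ f : ℕ → ℂ → ℂ, (∀ k, MemH2 (f k) ∧ h2NormSq (f k) ≤ 1) →
    ∃ (κ : ℕ → ℕ) (g : ℂ → ℂ), StrictMono κ ∧ MemH2 g ∧
      Tendsto (fun i => h2NormSq fun z => u z * f (κ i) (φ z) - g z) atTop (nhds 0)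

/-- The weighted composition operator `W_{u,φ}` is Hilbert–Schmidt on `H²`
(sum over the orthonormal basis `{z^k}` of `H²`). -/
def WCompHSH2 (u φ : ℂ → ℂ) : Prop :=
  WCompBddH2 u φ ∧ Summable fun k : ℕ => h2NormSq fun z => u z * φ z ^ k

/-- The function `u = (a₁ ∘ φ) · ∏_{j ≥ p} (φ − φ(ξⱼ))^{mⱼ} / a₁`, where `Λ j = φ(ξ j)`
are the non-tangential limits of `φ` at the zeros of the mate. -/
def ufun {n : ℕ} (p : ℕ) (ξ : Fin n → ℂ) (m : Fin n → ℕ) (Λ : Fin n → ℂ)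
    (φ : ℂ → ℂ) : ℂ → ℂ :=
  fun z => a1fun ξ m (φ z) *
    (∏ j ∈ Finset.univ.filter fun j : Fin n => p ≤ (j : ℕ), (φ z - Λ j) ^ (m j)) /
      a1fun ξ m z

/-- The reproducing kernel of the de Branges–Rovnyak space `H(c)`:
`k_λ^c(z) = (1 − conj(c(λ)) c(z)) / (1 − conj(λ) z)`, as a function of the parameter `λ`
and the evaluation point `z`. -/
def rkKernel (c : ℂ → ℂ) (lam z : ℂ) : ℂ :=
  (1 - (starRingEnd ℂ) (c lam) * c z) / (1 - (starRingEnd ℂ) lam * z)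

/-- `f` belongs to the reproducing kernel Hilbert space `H(c)` with squared norm at
most `t`: for all finite linear combinations of kernels,
`|⟨f, Σ αᵢ k_{λᵢ}⟩|² ≤ t · ‖Σ αᵢ k_{λᵢ}‖²`. -/
def HbRKBound (c f : ℂ → ℂ) (t : ℝ) : Prop :=
  ∀ (k : ℕ) (lam α : Fin k → ℂ), (∀ i, lam i ∈ unitDisk) →
    ‖∑ i, (starRingEnd ℂ) (α i) * f (lam i)‖ ^ 2 ≤
      t * (∑ i, ∑ j, α i * (starRingEnd ℂ) (α j) * rkKernel c (lam i) (lam j)).re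

/-- Membership in the de Branges–Rovnyak space `H(c)` (general RKHS definition). -/
def MemHbRK (c f : ℂ → ℂ) : Prop := ∃ t : ℝ, HbRKBound c f t

/-- `φ` has an angular derivative in the sense of Carathéodory at `ξ`:
`φ` and `φ'` have non-tangential limits at `ξ` and `|φ(ξ)| = 1`. -/
def HasADC (φ : ℂ → ℂ) (ξ : ℂ) : Prop :=
  ∃ L L' : ℂ, ‖L‖ = 1 ∧ NTLimit φ ξ L ∧ NTLimit (deriv φ) ξ L'

/-- The measure `μ_{u,φ}(E) = ∫_{φ⁻¹(E) ∩ T} |u|² dm` (boundary values on the circle,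
normalized Lebesgue measure). -/
def muMeas (u φ : ℂ → ℂ) (E : Set ℂ) : ENNReal :=
  (ENNReal.ofReal (2 * Real.pi))⁻¹ *
    ∫⁻ θ in Set.Ioc (0:ℝ) (2 * Real.pi),
      (if bdryVal φ (Complex.exp (θ * Complex.I)) ∈ E then
        ENNReal.ofReal (‖bdryVal u (Complex.exp (θ * Complex.I))‖ ^ 2) else 0)

/-- `μ_{u,φ}` is a Carleson measure: `μ(S(ζ,r)) ≤ M r` for all Carleson windows
`S(ζ,r) = {z : |z| ≤ 1, |z − ζ| ≤ r}`, `ζ ∈ T`, `0 < r < 1`. -/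
def IsCarleson (u φ : ℂ → ℂ) : Prop :=
  ∃ M : ℝ, 0 < M ∧ ∀ ζ ∈ unitCircle, ∀ r ∈ Set.Ioo (0:ℝ) 1,
    muMeas u φ (Metric.closedBall ζ r ∩ Metric.closedBall 0 1) ≤ ENNReal.ofReal (M * r)

/-- `μ_{u,φ}` is a vanishing Carleson measure: `sup_{ζ∈T} μ(S(ζ,r))/r → 0` as `r → 0`. -/
def IsVanishingCarleson (u φ : ℂ → ℂ) : Prop :=
  ∀ ε > (0:ℝ), ∃ r₀ ∈ Set.Ioo (0:ℝ) 1, ∀ r ∈ Set.Ioo (0:ℝ) r₀, ∀ ζ ∈ unitCircle,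
    muMeas u φ (Metric.closedBall ζ r ∩ Metric.closedBall 0 1) ≤ ENNReal.ofReal (ε * r)

/-- The reproducing kernel integral
`∫_T (1 − |w|²) |u(ξ)|² / |1 − conj(w) φ(ξ)|² dm(ξ)`. -/
def repKerInt (u φ : ℂ → ℂ) (w : ℂ) : ENNReal :=
  (ENNReal.ofReal (2 * Real.pi))⁻¹ *
    ∫⁻ θ in Set.Ioc (0:ℝ) (2 * Real.pi),
      ENNReal.ofReal ((1 - ‖w‖ ^ 2) * ‖bdryVal u (Complex.exp (θ * Complex.I))‖ ^ 2 /
        ‖1 - (starRingEnd ℂ) w * bdryVal φ (Complex.exp (θ * Complex.I))‖ ^ 2)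

section

/-- The model space `ℓ²`. -/
abbrev EE := lp (fun _ : ℕ => ℂ) 2

lemma EE_norm_sq (c : EE) : HasSum (fun k => ‖c k‖ ^ 2) (‖c‖ ^ 2) := by
  have := lp.hasSum_norm (p := 2) (by norm_num) c
  simpa using this

lemma EE_mem {f : ℕ → ℂ} (h : Summable fun k => ‖f k‖ ^ 2) : Memℓp f 2 := by
  apply memℓp_gen
  simpa using h

/-- element of `ℓ²` from a square-summable sequence -/
def mkE (f : ℕ → ℂ) (h : Summable fun k => ‖f k‖ ^ 2) : EE := ⟨f, EE_mem h⟩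

@[simp] lemma mkE_apply (f : ℕ → ℂ) (h) (k : ℕ) : mkE f h k = f k := rfl

lemma kvec_summable {z : ℂ} (hz : ‖z‖ < 1) :
    HasSum (fun k : ℕ => ‖(starRingEnd ℂ z) ^ k‖ ^ 2) ((1 - ‖z‖ ^ 2)⁻¹) := by
  have h1 : ‖z‖ ^ 2 < 1 := by nlinarith [norm_nonneg z]
  have := hasSum_geometric_of_lt_one (sq_nonneg ‖z‖) h1
  convert this using 2 with k
  rw [norm_pow, RCLike.norm_conj]; ring

/-- Szegő kernel vector -/
def kvec (z : ℂ) : EE :=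
  if hz : ‖z‖ < 1 then mkE (fun k => (starRingEnd ℂ z) ^ k) (kvec_summable hz).summable else 0

/-- the function with Taylor coefficients `c` -/
def ev2 (z : ℂ) : EE →L[ℂ] ℂ := innerSL ℂ (kvec z)

lemma mem_disk {z : ℂ} : z ∈ unitDisk ↔ ‖z‖ < 1 := by simp [unitDisk]

lemma ev2_hasSum {z : ℂ} (hz : z ∈ unitDisk) (c : EE) :
    HasSum (fun k => c k * z ^ k) (ev2 z c) := by
  have h := lp.hasSum_inner (𝕜 := ℂ) (kvec z) c
  have e : (fun i => inner ℂ (kvec z i) (c i)) = fun k => c k * z ^ k := by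
    funext k
    simp [kvec, mem_disk.1 hz]
  rw [e] at h
  exact h

lemma norm_kvec_sq {z : ℂ} (hz : z ∈ unitDisk) : ‖kvec z‖ ^ 2 = (1 - ‖z‖ ^ 2)⁻¹ := by
  have h := EE_norm_sq (kvec z)
  refine h.unique ?_
  convert kvec_summable (mem_disk.1 hz) using 2 with k
  simp [kvec, mem_disk.1 hz]

lemma ev2_fps {f : ℂ → ℂ} {c : EE} (h : ∀ z ∈ unitDisk, f z = ev2 z c) :
    HasFPowerSeriesOnBall f (FormalMultilinearSeries.ofScalars ℂ (fun k => c k)) 0 1 := by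
  refine ⟨?_, by norm_num, ?_⟩
  · have := FormalMultilinearSeries.le_radius_of_bound
      (FormalMultilinearSeries.ofScalars ℂ (fun k => c k)) (r := 1) ‖c‖ (fun n => by
        rw [FormalMultilinearSeries.ofScalars_norm]
        simpa using lp.norm_apply_le_norm (by norm_num) c n)
    simpa using this
  · intro y hy
    have hy' : y ∈ unitDisk := by
      rw [mem_disk]
      simpa [← enorm_eq_nnnorm, ← ofReal_norm] using hy
    rw [zero_add, h y hy']
    have := ev2_hasSum hy' c
    have e : (fun n => (FormalMultilinearSeries.ofScalars ℂ (fun k => c k) n) fun _ => y) =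
        fun k => c k * y ^ k := by
      funext k
      rw [FormalMultilinearSeries.ofScalars_apply_eq]
      simp
    rw [e]
    exact this

lemma ev2_diff {f : ℂ → ℂ} {c : EE} (h : ∀ z ∈ unitDisk, f z = ev2 z c) :
    DifferentiableOn ℂ f unitDisk := by
  have := (ev2_fps h).differentiableOn
  have e : unitDisk = Metric.eball (0 : ℂ) 1 := by
    ext z
    simp [mem_disk, ← ofReal_norm]
  rw [e]
  exact this

lemma ev2_taylor {f : ℂ → ℂ} {c : EE} (h : ∀ z ∈ unitDisk, f z = ev2 z c) (k : ℕ) :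
    taylorCoeff f k = c k := by
  have := (ev2_fps h).factorial_smul 1 k
  rw [FormalMultilinearSeries.ofScalars_apply_eq] at this
  have h2 : (k.factorial : ℂ) ≠ 0 := by exact_mod_cast k.factorial_ne_zero
  rw [taylorCoeff, iteratedDeriv_eq_iteratedFDeriv, ← this]
  field_simp
  simp

lemma memH2_of_ev2 {f : ℂ → ℂ} {c : EE} (h : ∀ z ∈ unitDisk, f z = ev2 z c) :
    MemH2 f ∧ h2NormSq f = ‖c‖ ^ 2 := by
  have hs := EE_norm_sq c
  simp only [← ev2_taylor h] at hs
  exact ⟨⟨ev2_diff h, hs.summable⟩, hs.tsum_eq⟩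

lemma diff_hasSum {f : ℂ → ℂ} (h : DifferentiableOn ℂ f unitDisk) {z : ℂ} (hz : z ∈ unitDisk) :
    HasSum (fun k => taylorCoeff f k * z ^ k) (f z) := by
  have := Complex.hasSum_taylorSeries_on_ball (r := 1) h hz
  have e : (fun k : ℕ => taylorCoeff f k * z ^ k) =
      fun n : ℕ => (n.factorial : ℂ)⁻¹ • (z - 0) ^ n • iteratedDeriv n f 0 := by
    funext k
    simp only [taylorCoeff, sub_zero, smul_eq_mul]
    ring
  rw [e]
  exact this

lemma memH2_exists {f : ℂ → ℂ} (h : MemH2 f) : ∃ c : EE, ∀ z ∈ unitDisk, f z = ev2 z c := by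
  refine ⟨mkE (taylorCoeff f) h.2, fun z hz => ?_⟩
  have h1 := diff_hasSum h.1 hz
  have h2 := ev2_hasSum hz (mkE (taylorCoeff f) h.2)
  simp only [mkE_apply] at h2
  exact h1.unique h2

lemma ev2_inj {c c' : EE} (h : ∀ z ∈ unitDisk, ev2 z c = ev2 z c') : c = c' := by
  ext k
  rw [← ev2_taylor (f := fun z => ev2 z c) (fun _ _ => rfl) k, ← ev2_taylor (c := c') h k]

lemma ev2_growth {z : ℂ} (hz : z ∈ unitDisk) (c : EE) :
    (1 - ‖z‖) * ‖ev2 z c‖ ^ 2 ≤ ‖c‖ ^ 2 := by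
  have h1 : ‖ev2 z c‖ ≤ ‖kvec z‖ * ‖c‖ := norm_inner_le_norm (𝕜 := ℂ) (kvec z) c
  have h2 := norm_kvec_sq hz
  have hz1 := mem_disk.1 hz
  have hn := norm_nonneg z
  have h3 : ‖ev2 z c‖ ^ 2 ≤ (1 - ‖z‖ ^ 2)⁻¹ * ‖c‖ ^ 2 := by
    rw [← h2, ← mul_pow]; gcongr
  have hp : 0 < 1 - ‖z‖ ^ 2 := by nlinarith
  calc (1 - ‖z‖) * ‖ev2 z c‖ ^ 2 ≤ (1 - ‖z‖ ^ 2) * ‖ev2 z c‖ ^ 2 := by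
        gcongr; nlinarith
    _ ≤ (1 - ‖z‖ ^ 2) * ((1 - ‖z‖ ^ 2)⁻¹ * ‖c‖ ^ 2) := by gcongr
    _ = ‖c‖ ^ 2 := by field_simp

end

section

/-- trigonometric series with absolutely summable coefficients -/
def Fc (a : ℕ → ℂ) : C(UnitAddCircle, ℂ) := ∑' k : ℕ, a k • (fourier (k : ℤ) : C(UnitAddCircle, ℂ))

lemma Fc_hasSum {a : ℕ → ℂ} (h : Summable fun k => ‖a k‖) :
    HasSum (fun k : ℕ => a k • (fourier (k : ℤ) : C(UnitAddCircle, ℂ))) (Fc a) := by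
  apply Summable.hasSum
  apply Summable.of_norm
  refine h.congr fun k => ?_
  rw [norm_smul, fourier_norm, mul_one]

lemma Fc_apply {a : ℕ → ℂ} (h : Summable fun k => ‖a k‖) (x : UnitAddCircle) :
    HasSum (fun k : ℕ => a k * (AddCircle.toCircle x : ℂ) ^ k) (Fc a x) := by
  have h1 := ContinuousMap.hasSum_apply (Fc_hasSum h) x
  have e : (fun i : ℕ => (a i • (fourier (i : ℤ) : C(UnitAddCircle, ℂ))) x) =
      fun k : ℕ => a k * (AddCircle.toCircle x : ℂ) ^ k := by
    funext k
    simp [fourier_apply, AddCircle.toCircle_nsmul]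
  rw [e] at h1
  exact h1

lemma Fc_norm {a : ℕ → ℂ} (h : Summable fun k => ‖a k‖) :
    HasSum (fun k => ‖a k‖ ^ 2)
      (‖ContinuousMap.toLp (E := ℂ) 2 (AddCircle.haarAddCircle (T := 1)) ℂ (Fc a)‖ ^ 2) := by
  have h1 := (Fc_hasSum h).mapL
    (ContinuousMap.toLp (E := ℂ) 2 (AddCircle.haarAddCircle (T := 1)) ℂ)
  have h2 : Tendsto (fun K : ℕ => ‖∑ k ∈ Finset.range K, a k • fourierLp (T := 1) 2 (k : ℤ)‖ ^ 2)
      atTop (nhds (‖ContinuousMap.toLp (E := ℂ) 2 (AddCircle.haarAddCircle (T := 1)) ℂ (Fc a)‖ ^ 2)) := by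
    refine Tendsto.pow (Tendsto.norm ?_) 2
    have := h1.tendsto_sum_nat
    refine this.congr fun K => ?_
    refine Finset.sum_congr rfl fun k _ => ?_
    rw [map_smul]
  have ho : Orthonormal ℂ (fun k : ℕ => fourierLp (T := 1) 2 (k : ℤ)) :=
    (orthonormal_fourier (T := 1)).comp _ Nat.cast_injective
  have h3 : ∀ K : ℕ, ‖∑ k ∈ Finset.range K, a k • fourierLp (T := 1) 2 (k : ℤ)‖ ^ 2 =
      ∑ k ∈ Finset.range K, ‖a k‖ ^ 2 := by
    intro K
    have := ho.inner_sum a a (Finset.range K)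
    rw [inner_self_eq_norm_sq_to_K] at this
    have h4 : (∑ k ∈ Finset.range K, (starRingEnd ℂ) (a k) * a k) =
        ((∑ k ∈ Finset.range K, ‖a k‖ ^ 2 : ℝ) : ℂ) := by
      push_cast
      exact Finset.sum_congr rfl fun k _ => by rw [Complex.conj_mul']
    rw [h4] at this
    apply Complex.ofReal_injective
    rw [← this]
    simp
  simp only [h3] at h2
  rw [hasSum_iff_tendsto_nat_of_nonneg (fun _ => by positivity)]
  exact h2

lemma coeff_summable {f : ℂ → ℂ} (hf : DifferentiableOn ℂ f unitDisk) {r : ℝ} (hr0 : 0 ≤ r)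
    (hr : r < 1) : Summable fun k : ℕ => ‖taylorCoeff f k * (r : ℂ) ^ k‖ := by
  have hz : (r : ℂ) ∈ unitDisk := by
    rw [mem_disk, Complex.norm_real, Real.norm_of_nonneg hr0]; exact hr
  exact (diff_hasSum hf hz).summable.norm

lemma Fc_eq {f : ℂ → ℂ} (hf : DifferentiableOn ℂ f unitDisk) {r : ℝ} (hr0 : 0 ≤ r)
    (hr : r < 1) (x : UnitAddCircle) :
    Fc (fun k : ℕ => taylorCoeff f k * (r : ℂ) ^ k) x = f (r * AddCircle.toCircle x) := by
  have h1 := Fc_apply (coeff_summable hf hr0 hr) x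
  have hz : (r : ℂ) * AddCircle.toCircle x ∈ unitDisk := by
    rw [mem_disk, norm_mul, Complex.norm_real, Real.norm_of_nonneg hr0, Circle.norm_coe, mul_one]; exact hr
  have h2 := diff_hasSum hf hz
  refine h1.unique ?_
  simpa only [mul_pow, mul_assoc] using h2

lemma radial_le {f g : ℂ → ℂ} (hf : DifferentiableOn ℂ f unitDisk)
    (hg : DifferentiableOn ℂ g unitDisk) (hfg : ∀ z ∈ unitDisk, ‖f z‖ ≤ ‖g z‖)
    {r : ℝ} (hr0 : 0 ≤ r) (hr : r < 1) :
    ∑' k, ‖taylorCoeff f k * (r : ℂ) ^ k‖ ^ 2 ≤ ∑' k, ‖taylorCoeff g k * (r : ℂ) ^ k‖ ^ 2 := by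
  rw [(Fc_norm (coeff_summable hf hr0 hr)).tsum_eq, (Fc_norm (coeff_summable hg hr0 hr)).tsum_eq]
  refine pow_le_pow_left₀ (norm_nonneg _) ?_ 2
  apply Lp.norm_le_norm_of_ae_le
  filter_upwards [ContinuousMap.coeFn_toLp (E := ℂ) (𝕜 := ℂ) (p := 2) (AddCircle.haarAddCircle (T := 1))
    (Fc (fun k : ℕ => taylorCoeff f k * (r : ℂ) ^ k)),
    ContinuousMap.coeFn_toLp (E := ℂ) (𝕜 := ℂ) (p := 2) (AddCircle.haarAddCircle (T := 1))
    (Fc (fun k : ℕ => taylorCoeff g k * (r : ℂ) ^ k))] with x h1 h2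
  rw [h1, h2, Fc_eq hf hr0 hr, Fc_eq hg hr0 hr]
  apply hfg
  rw [mem_disk, norm_mul, Complex.norm_real, Real.norm_of_nonneg hr0, Circle.norm_coe, mul_one]; exact hr

lemma mul_bdd {φ : ℂ → ℂ} (hφ : MemBallHinf φ) (c : EE) :
    ∃ c' : EE, ∀ z ∈ unitDisk, φ z * ev2 z c = ev2 z c' := by
  have hg : DifferentiableOn ℂ (fun z => ev2 z c) unitDisk := ev2_diff (c := c) fun _ _ => rfl
  have hf : DifferentiableOn ℂ (fun z => φ z * ev2 z c) unitDisk := hφ.1.mul hg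
  apply memH2_exists
  refine ⟨hf, ?_⟩
  set d := taylorCoeff (fun z => φ z * ev2 z c) with hd
  have hle : ∀ r : ℝ, 0 ≤ r → r < 1 → ∀ K : ℕ,
      ∑ k ∈ Finset.range K, ‖d k * (r : ℂ) ^ k‖ ^ 2 ≤ ‖c‖ ^ 2 := by
    intro r hr0 hr K
    have h1 := radial_le hf hg (fun z hz => by
      rw [norm_mul]
      exact mul_le_of_le_one_left (norm_nonneg _) (hφ.2 z hz)) hr0 hr
    have h2 := (Fc_norm (coeff_summable hf hr0 hr)).summable
    have h3 := (Fc_norm (coeff_summable hg hr0 hr)).summable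
    refine (h2.sum_le_tsum _ (fun _ _ => by positivity)).trans (h1.trans ?_)
    refine (h3.tsum_le_tsum (fun k => ?_) (EE_norm_sq c).summable).trans (EE_norm_sq c).tsum_eq.le
    rw [ev2_taylor (c := c) (fun _ _ => rfl), norm_mul, norm_pow, Complex.norm_real,
      Real.norm_of_nonneg hr0]
    gcongr
    exact mul_le_of_le_one_right (norm_nonneg _) (pow_le_one₀ hr0 hr.le)
  refine summable_of_sum_range_le (c := ‖c‖ ^ 2) (fun _ => by positivity) fun K => ?_
  have ht : Tendsto (fun r : ℝ => ∑ k ∈ Finset.range K, ‖d k * (r : ℂ) ^ k‖ ^ 2)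
      (nhdsWithin 1 (Set.Iio 1)) (nhds (∑ k ∈ Finset.range K, ‖d k * ((1 : ℝ) : ℂ) ^ k‖ ^ 2)) := by
    apply Continuous.continuousWithinAt (x := (1 : ℝ))
    fun_prop
  have h5 := le_of_tendsto ht (b := ‖c‖ ^ 2) (by
    have : Set.Ioo (0 : ℝ) 1 ∈ nhdsWithin (1 : ℝ) (Set.Iio 1) := Ioo_mem_nhdsLT (by norm_num)
    filter_upwards [this] with r hr
    exact hle r hr.1.le hr.2 K)
  simpa using h5

end

section

/-- unilateral shift -/
def shFun (c : ℕ → ℂ) : ℕ → ℂ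
  | 0 => 0
  | k + 1 => c k

lemma shFun_hasSum (c : EE) : HasSum (fun k => ‖shFun c k‖ ^ 2) (‖c‖ ^ 2) := by
  have h : HasSum (fun k => ‖shFun c (k + 1)‖ ^ 2) (‖c‖ ^ 2) := EE_norm_sq c
  have := (hasSum_nat_add_iff (f := fun k => ‖shFun c k‖ ^ 2) 1).1 h
  simpa [shFun] using this

def Sh : EE →L[ℂ] EE :=
  LinearMap.mkContinuous
    { toFun := fun c => mkE (shFun c) (shFun_hasSum c).summable
      map_add' := fun c d => by
        ext k
        cases k <;> simp [shFun]
      map_smul' := fun a c => by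
        ext k
        cases k <;> simp [shFun] } 1 (fun c => by
      have h1 := (EE_norm_sq (mkE (shFun c) (shFun_hasSum c).summable)).unique (shFun_hasSum c)
      have h2 : ‖mkE (shFun c) (shFun_hasSum c).summable‖ = ‖c‖ :=
        (sq_eq_sq₀ (norm_nonneg _) (norm_nonneg _)).1 h1
      rw [one_mul]
      exact h2.le)

@[simp] lemma Sh_zero (c : EE) : Sh c 0 = 0 := rfl
@[simp] lemma Sh_succ (c : EE) (k : ℕ) : Sh c (k + 1) = c k := rfl

lemma Sh_norm : ‖Sh‖ ≤ 1 := LinearMap.mkContinuous_norm_le _ zero_le_one _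

/-- basis vector -/
def eb (k : ℕ) : EE := lp.single 2 k (1 : ℂ)

lemma eb_apply (k i : ℕ) : eb k i = if i = k then 1 else 0 := by
  simp [eb, lp.single_apply, Pi.single_apply]

lemma Sh_eb (k : ℕ) : Sh (eb k) = eb (k + 1) := by
  ext i
  cases i <;> simp [eb_apply]

lemma ev2_eb {z : ℂ} (hz : z ∈ unitDisk) (k : ℕ) : ev2 z (eb k) = z ^ k := by
  refine (ev2_hasSum hz (eb k)).unique ?_
  have := hasSum_single (f := fun i => eb k i * z ^ i) k (fun i hi => by simp [eb_apply, hi])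
  simpa [eb_apply] using this

lemma ev2_Sh {z : ℂ} (hz : z ∈ unitDisk) (c : EE) : ev2 z (Sh c) = z * ev2 z c := by
  have h1 := ev2_hasSum hz c
  have h2 := ev2_hasSum hz (Sh c)
  have h3 := (hasSum_nat_add_iff' (f := fun k => Sh c k * z ^ k) 1).2 h2
  simp only [Sh_succ, Finset.range_one, Finset.sum_singleton, Sh_zero, zero_mul, sub_zero] at h3
  refine h3.unique ?_
  have h4 := h1.mul_left z
  have e : (fun i => z * (c i * z ^ i)) = fun n => c n * z ^ (n + 1) := by
    funext i; ring
  rw [e] at h4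
  exact h4

open Polynomial in
lemma ev2_aeval {z : ℂ} (hz : z ∈ unitDisk) (P : Polynomial ℂ) (c : EE) :
    ev2 z (aeval Sh P c) = P.eval z * ev2 z c := by
  induction P using Polynomial.induction_on' with
  | add p q hp hq => simp [hp, hq, add_mul]
  | monomial n a =>
    rw [aeval_monomial]
    have : ∀ n : ℕ, ev2 z ((Sh ^ n) c) = z ^ n * ev2 z c := by
      intro n
      induction n with
      | zero => simp
      | succ n ih => rw [pow_succ', mul_apply_eq_comp, ev2_Sh hz, ih]; ring
    rw [Algebra.algebraMap_eq_smul_one, smul_mul_assoc, one_mul, smul_apply, map_smul, this,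
      eval_monomial, smul_eq_mul]
    ring

lemma shift_division {lam : ℂ} (hl : ‖lam‖ < 1) :
    ∃ (D : EE →L[ℂ] EE) (δ : EE →L[ℂ] ℂ), ∀ c : EE, c = Sh (D c) - lam • D c + δ c • eb 0 := by
  set Bk := ContinuousLinearMap.adjoint Sh with hB
  have hBk : ∀ (c : EE) (k : ℕ), Bk c k = c (k + 1) := by
    intro c k
    have h1 : inner ℂ (eb k) (Bk c) = inner ℂ (Sh (eb k)) c :=
      ContinuousLinearMap.adjoint_inner_right Sh (eb k) c
    rw [Sh_eb, eb, eb, lp.inner_single_left, lp.inner_single_left] at h1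
    simpa using h1
  have hn : ‖lam • Bk‖ < 1 := by
    rw [norm_smul, hB, LinearIsometryEquiv.norm_map]
    calc ‖lam‖ * ‖Sh‖ ≤ ‖lam‖ * 1 := by gcongr; exact Sh_norm
      _ < 1 := by simpa using hl
  obtain ⟨R, hR⟩ : ∃ R : EE →L[ℂ] EE, (1 - lam • Bk) * R = 1 :=
    (isUnit_one_sub_of_norm_lt_one hn).exists_right_inv
  have hR' : ∀ c, R c - lam • Bk (R c) = c := fun c => by
    have := DFunLike.congr_fun hR c
    simpa using this
  refine ⟨Bk * R, (lp.evalCLM ℂ (fun _ : ℕ => ℂ) 2 0) ∘L R, fun c => ?_⟩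
  ext k
  have := congrArg (fun f : EE => f k) (hR' c)
  simp only [lp.coeFn_sub, lp.coeFn_smul, Pi.sub_apply, Pi.smul_apply, smul_eq_mul, hBk] at this
  have key : ∀ (d : EE) (k : ℕ), (Sh d - lam • d + (R c 0) • eb 0 : EE) k =
      Sh d k - lam * d k + (R c 0) * eb 0 k := fun _ _ => rfl
  refine Eq.trans ?_ (key ((Bk * R) c) k).symm
  have hc : ∀ k, (Bk * R) c k = R c (k + 1) := fun k => hBk (R c) k
  rw [← this, hc]
  cases k with
  | zero =>
    simp [eb_apply]; ring
  | succ k =>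
    simp [eb_apply, hBk]

/-- `A` has the uniqueness property for decompositions -/
def GoodP (A : Polynomial ℂ) : Prop :=
  ∀ (c : EE) (q : Polynomial ℂ), (∀ z ∈ unitDisk, A.eval z * ev2 z c + q.eval z = 0) → A ∣ q

lemma radial_mem {ξ : ℂ} (hξ : ‖ξ‖ = 1) {r : ℝ} (hr : r ∈ Set.Ioo (0 : ℝ) 1) :
    (r : ℂ) * ξ ∈ unitDisk := by
  rw [mem_disk, norm_mul, hξ, mul_one, Complex.norm_real, Real.norm_of_nonneg hr.1.le]; exact hr.2

lemma radial_tendsto (ξ : ℂ) :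
    Tendsto (fun r : ℝ => (r : ℂ) * ξ) (nhdsWithin 1 (Set.Iio 1)) (nhds ξ) := by
  have : ContinuousWithinAt (fun r : ℝ => (r : ℂ) * ξ) (Set.Iio 1) 1 := by
    apply Continuous.continuousWithinAt; fun_prop
  simpa [ContinuousWithinAt] using this

lemma Ioo_mem_left : Set.Ioo (0 : ℝ) 1 ∈ nhdsWithin (1 : ℝ) (Set.Iio 1) :=
  Ioo_mem_nhdsLT (by norm_num)

lemma radial_zero {ξ : ℂ} (hξ : ‖ξ‖ = 1) (c : EE) :
    Tendsto (fun r : ℝ => ((r : ℂ) * ξ - ξ) * ev2 ((r : ℂ) * ξ) c) (nhdsWithin 1 (Set.Iio 1))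
      (nhds 0) := by
  rw [tendsto_zero_iff_norm_tendsto_zero]
  have h0 : Tendsto (fun r : ℝ => Real.sqrt ((1 - r) * ‖c‖ ^ 2)) (nhdsWithin 1 (Set.Iio 1))
      (nhds 0) := by
    have : ContinuousWithinAt (fun r : ℝ => Real.sqrt ((1 - r) * ‖c‖ ^ 2)) (Set.Iio 1) 1 := by
      apply Continuous.continuousWithinAt; fun_prop
    simpa [ContinuousWithinAt] using this
  refine squeeze_zero' (Eventually.of_forall fun _ => norm_nonneg _) ?_ h0
  filter_upwards [Ioo_mem_left] with r hr
  apply Real.le_sqrt_of_sq_le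
  have h1 := ev2_growth (radial_mem hξ hr) c
  have h2 : ‖(r : ℂ) * ξ‖ = r := by
    rw [norm_mul, hξ, mul_one, Complex.norm_real, Real.norm_of_nonneg hr.1.le]
  have h3 : ‖(r : ℂ) * ξ - ξ‖ = 1 - r := by
    have : (r : ℂ) * ξ - ξ = ((r - 1 : ℝ) : ℂ) * ξ := by push_cast; ring
    rw [this, norm_mul, hξ, mul_one, Complex.norm_real, Real.norm_eq_abs, abs_sub_comm,
      abs_of_pos (by linarith [hr.2])]
  rw [h2] at h1
  rw [norm_mul, h3, mul_pow, sq (1 - r), mul_assoc]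
  exact mul_le_mul_of_nonneg_left h1 (by linarith [hr.2])

/-- boundary value of the polynomial part -/
lemma radial_poly {ξ : ℂ} (hξ : ‖ξ‖ = 1) (A q : Polynomial ℂ) (c : EE) :
    Tendsto (fun r : ℝ => ((r : ℂ) * ξ - ξ) * A.eval ((r : ℂ) * ξ) * ev2 ((r : ℂ) * ξ) c
      + q.eval ((r : ℂ) * ξ)) (nhdsWithin 1 (Set.Iio 1)) (nhds (q.eval ξ)) := by
  have h1 := radial_zero hξ c
  have h2 := (A.continuous.tendsto ξ).comp (radial_tendsto ξ)
  have h3 := (q.continuous.tendsto ξ).comp (radial_tendsto ξ)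
  have h4 := (h1.mul h2).add h3
  rw [zero_mul, zero_add] at h4
  refine h4.congr fun r => ?_
  simp only [Function.comp]
  ring

open Polynomial in
lemma GoodP.step {A : ℂ[X]} (hA : GoodP A) {ξ : ℂ} (hξ : ‖ξ‖ = 1) : GoodP ((X - C ξ) * A) := by
  intro c q h
  have hq : q.eval ξ = 0 := by
    have h1 := radial_poly hξ A q c
    refine (tendsto_nhds_unique (h1.congr' ?_) tendsto_const_nhds)
    filter_upwards [Ioo_mem_left] with r hr
    have := h _ (radial_mem hξ hr)
    simpa using this
  obtain ⟨q', rfl⟩ := dvd_iff_isRoot.2 hq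
  refine mul_dvd_mul_left _ (hA c q' fun z hz => ?_)
  have := h z hz
  simp only [eval_mul, eval_sub, eval_X, eval_C, mul_assoc, ← mul_add] at this
  refine (mul_eq_zero.1 this).resolve_left fun h0 => ?_
  rw [sub_eq_zero] at h0
  rw [mem_disk, h0, hξ] at hz
  exact lt_irrefl _ hz

lemma GoodP.one : GoodP 1 := fun _ q _ => one_dvd q

open Polynomial in
lemma GoodP.pow {A : ℂ[X]} (hA : GoodP A) {ξ : ℂ} (hξ : ‖ξ‖ = 1) (m : ℕ) :
    GoodP ((X - C ξ) ^ m * A) := by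
  induction m with
  | zero => simpa using hA
  | succ m ih => rw [pow_succ', mul_assoc]; exact ih.step hξ

open Polynomial in
lemma GoodP.prod {ι : Type*} (s : Finset ι) (ξ : ι → ℂ) (hξ : ∀ j, ‖ξ j‖ = 1) (m : ι → ℕ) :
    GoodP (∏ j ∈ s, (X - C (ξ j)) ^ m j) := by
  induction s using Finset.induction_on with
  | empty => simpa using GoodP.one
  | insert j s hj ih => rw [Finset.prod_insert hj]; exact ih.pow (hξ j) _

end

section

open Polynomial

/-- coefficient space of polynomials of degree `< N` -/
abbrev VV (N : ℕ) := EuclideanSpace ℂ (Fin N)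

/-- model of `H(b)` -/
abbrev KK (N : ℕ) := EE × VV N

def polyV (N : ℕ) : VV N →ₗ[ℂ] ℂ[X] where
  toFun v := ∑ i : Fin N, monomial (i : ℕ) (v i)
  map_add' v w := by simp [Finset.sum_add_distrib]
  map_smul' a v := by simp [Finset.smul_sum, smul_monomial]

lemma polyV_apply {N : ℕ} (v : VV N) : polyV N v = ∑ i : Fin N, monomial (i : ℕ) (v i) := rfl

lemma polyV_coeff {N : ℕ} (v : VV N) (i : Fin N) : (polyV N v).coeff i = v i := by
  rw [polyV_apply, finsetSum_coeff, Finset.sum_eq_single i]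
  · simp
  · intro j _ hj
    rw [coeff_monomial, if_neg]
    exact fun h => hj (Fin.ext h)
  · simp

lemma polyV_degree {N : ℕ} (v : VV N) : (polyV N v).degree < (N : WithBot ℕ) := by
  rw [degree_lt_iff_coeff_zero]
  intro k hk
  rw [polyV_apply, finsetSum_coeff]
  refine Finset.sum_eq_zero fun i _ => ?_
  rw [coeff_monomial, if_neg]
  have := i.2
  omega

lemma polyV_surj {N : ℕ} {q : ℂ[X]} (hq : q.degree < (N : WithBot ℕ)) :
    ∃ v : VV N, polyV N v = q := by
  refine ⟨WithLp.toLp 2 fun i => q.coeff i, ?_⟩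
  ext k
  by_cases hk : k < N
  · exact polyV_coeff (WithLp.toLp 2 fun i : Fin N => q.coeff i) ⟨k, hk⟩
  · push Not at hk
    rw [(degree_lt_iff_coeff_zero _ _).1 hq k hk, (degree_lt_iff_coeff_zero _ _).1 (polyV_degree _) k hk]

lemma polyV_inj {N : ℕ} {v : VV N} (h : polyV N v = 0) : v = 0 := by
  ext i
  rw [← polyV_coeff, h]; simp

lemma poly_rep (q : ℂ[X]) : ∃ c : EE, (∀ k, c k = q.coeff k) ∧
    ∀ z ∈ unitDisk, q.eval z = ev2 z c := by
  have hs : Summable fun k => ‖q.coeff k‖ ^ 2 := by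
    apply summable_of_ne_finset_zero (s := q.support)
    intro k hk
    simp [notMem_support_iff.1 hk]
  refine ⟨mkE q.coeff hs, fun _ => rfl, fun z hz => ?_⟩
  refine HasSum.unique ?_ (ev2_hasSum hz _)
  rw [eval_eq_sum, Polynomial.sum]
  apply hasSum_sum_of_ne_finset_zero
  intro k hk
  simp [notMem_support_iff.1 hk]

lemma polyV_h2 {N : ℕ} (v : VV N) : h2NormSq (fun z => (polyV N v).eval z) = ‖v‖ ^ 2 := by
  obtain ⟨c, hc, hz⟩ := poly_rep (polyV N v)
  rw [(memH2_of_ev2 hz).2, ← (EE_norm_sq c).tsum_eq, EuclideanSpace.norm_sq_eq]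
  simp only [hc]
  rw [tsum_eq_sum (s := Finset.range N), Finset.sum_range]
  · exact Finset.sum_congr rfl fun i _ => by rw [polyV_coeff]
  · intro k hk
    rw [(degree_lt_iff_coeff_zero _ _).1 (polyV_degree v) k (by simpa using hk)]; simp

/-- evaluation on the model of `H(b)` -/
def evB (A : ℂ[X]) {N : ℕ} (z : ℂ) (x : KK N) : ℂ := A.eval z * ev2 z x.1 + (polyV N x.2).eval z

lemma evB_add (A : ℂ[X]) {N : ℕ} (z : ℂ) (x y : KK N) : evB A z (x + y) = evB A z x + evB A z y := by
  simp [evB]; ring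

lemma evB_smul (A : ℂ[X]) {N : ℕ} (z : ℂ) (a : ℂ) (x : KK N) : evB A z (a • x) = a * evB A z x := by
  simp [evB, mul_add]; ring

lemma evB_sub (A : ℂ[X]) {N : ℕ} (z : ℂ) (x y : KK N) : evB A z (x - y) = evB A z x - evB A z y := by
  have := evB_add A z (x - y) y
  rw [sub_add_cancel] at this
  rw [this]; ring

/-- the data of the polynomial `a₁` -/
structure GoodA (A : ℂ[X]) (N : ℕ) : Prop where
  good : GoodP A
  monic : A.Monic
  deg : A.natDegree = N
  ne : ∀ z ∈ unitDisk, A.eval z ≠ 0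

variable {A : ℂ[X]} {N : ℕ}

lemma GoodA.degree (hA : GoodA A N) : A.degree = (N : WithBot ℕ) := by
  rw [degree_eq_natDegree hA.monic.ne_zero, hA.deg]

lemma GoodA.zero_of_dvd (hA : GoodA A N) {v : VV N} (h : A ∣ polyV N v) : v = 0 := by
  apply polyV_inj
  apply eq_zero_of_dvd_of_degree_lt h
  rw [hA.degree]
  exact polyV_degree v

lemma GoodA.inj0 (hA : GoodA A N) {x : KK N} (h : ∀ z ∈ unitDisk, evB A z x = 0) : x = 0 := by
  have h2 : x.2 = 0 := hA.zero_of_dvd (hA.good x.1 _ h)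
  have h1 : x.1 = 0 := by
    apply ev2_inj
    intro z hz
    have := h z hz
    simpa [evB, h2, hA.ne z hz] using this
  exact Prod.ext h1 h2

lemma GoodA.inj (hA : GoodA A N) {x y : KK N} (h : ∀ z ∈ unitDisk, evB A z x = evB A z y) :
    x = y := by
  rw [← sub_eq_zero]
  apply hA.inj0
  intro z hz
  rw [evB_sub, h z hz, sub_self]

/-- any decomposition can be reduced -/
lemma GoodA.reduce (hA : GoodA A N) (c : EE) (q : ℂ[X]) :
    ∃ x : KK N, ∀ z ∈ unitDisk, A.eval z * ev2 z c + q.eval z = evB A z x := by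
  obtain ⟨d, -, hd⟩ := poly_rep (q /ₘ A)
  obtain ⟨v, hv⟩ := polyV_surj (N := N) (q := q %ₘ A)
    (by rw [← hA.degree]; exact degree_modByMonic_lt q hA.monic)
  refine ⟨(c + d, v), fun z hz => ?_⟩
  have := congrArg (eval z) (modByMonic_add_div q A)
  simp only [eval_add, eval_mul] at this
  rw [evB, hv, ← this, map_add, ← hd z hz]
  ring

lemma GoodA.mul_phi (hA : GoodA A N) {φ : ℂ → ℂ} (hφ : MemBallHinf φ) {xφ : KK N}
    (hx : ∀ z ∈ unitDisk, φ z = evB A z xφ) (c : EE) (q : ℂ[X]) :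
    ∃ d : EE, ∀ z ∈ unitDisk, φ z * (A.eval z * ev2 z c + q.eval z) =
      A.eval z * ev2 z d + (polyV N xφ.2 * q).eval z := by
  obtain ⟨c', hc'⟩ := mul_bdd hφ c
  refine ⟨c' + aeval Sh q xφ.1, fun z hz => ?_⟩
  rw [map_add, ev2_aeval hz, ← hc' z hz, eval_mul, mul_add]
  have : φ z * q.eval z = evB A z xφ * q.eval z := by rw [hx z hz]
  rw [this, evB]; ring

lemma GoodA.pow_phi (hA : GoodA A N) {φ : ℂ → ℂ} (hφ : MemBallHinf φ) {xφ : KK N}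
    (hx : ∀ z ∈ unitDisk, φ z = evB A z xφ) (k : ℕ) :
    ∃ x : KK N, ∀ z ∈ unitDisk, φ z ^ k = evB A z x := by
  induction k with
  | zero =>
    obtain ⟨x, hx⟩ := hA.reduce 0 1
    exact ⟨x, fun z hz => by rw [← hx z hz]; simp⟩
  | succ k ih =>
    obtain ⟨x, hx'⟩ := ih
    obtain ⟨d, hd⟩ := hA.mul_phi hφ hx x.1 (polyV N x.2)
    obtain ⟨y, hy⟩ := hA.reduce d (polyV N xφ.2 * polyV N x.2)
    exact ⟨y, fun z hz => by rw [pow_succ', hx' z hz, ← hy z hz, ← hd z hz, evB]⟩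

lemma GoodA.poly_phi (hA : GoodA A N) {φ : ℂ → ℂ} (hφ : MemBallHinf φ) {xφ : KK N}
    (hx : ∀ z ∈ unitDisk, φ z = evB A z xφ) (P : ℂ[X]) :
    ∃ x : KK N, ∀ z ∈ unitDisk, P.eval (φ z) = evB A z x := by
  induction P using Polynomial.induction_on' with
  | add p q hp hq =>
    obtain ⟨x, h1⟩ := hp
    obtain ⟨y, h2⟩ := hq
    exact ⟨x + y, fun z hz => by rw [evB_add, ← h1 z hz, ← h2 z hz, eval_add]⟩
  | monomial n a =>
    obtain ⟨x, h1⟩ := hA.pow_phi hφ hx n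
    exact ⟨a • x, fun z hz => by rw [evB_smul, ← h1 z hz, eval_monomial]⟩

end

section

open Polynomial

variable {A : ℂ[X]} {N : ℕ}

lemma functional_zero (L : EE →L[ℂ] ℂ) {lam : ℂ} (hl : ‖lam‖ = 1)
    (h : ∀ c, L (Sh c) = lam * L c) : L = 0 := by
  set v : EE := (InnerProductSpace.toDual ℂ EE).symm L with hv
  have hL : ∀ c, L c = inner ℂ v c := fun c => by
    rw [hv, InnerProductSpace.toDual_symm_apply]
  have h1 : ∀ k, ‖v k‖ = ‖L (eb k)‖ := by
    intro k
    rw [hL, eb, lp.inner_single_right]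
    simp
  have h2 : ∀ k, ‖L (eb k)‖ = ‖L (eb 0)‖ := by
    intro k
    induction k with
    | zero => rfl
    | succ k ih => rw [← Sh_eb, h, norm_mul, hl, one_mul, ih]
  have h3 := (EE_norm_sq v).summable.tendsto_atTop_zero
  simp only [h1, h2] at h3
  have h4 : ‖L (eb 0)‖ ^ 2 = 0 := tendsto_nhds_unique tendsto_const_nhds h3
  have h5 : ‖L (eb 0)‖ = 0 := by simpa using h4
  have h6 : v = 0 := by
    ext k
    exact norm_eq_zero.1 ((h1 k).trans ((h2 k).trans h5))
  ext c
  rw [hL, h6]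
  simp

/-- `T` represents `C_φ` -/
def IsT (A : ℂ[X]) (N : ℕ) (φ : ℂ → ℂ) (T : KK N →L[ℂ] KK N) : Prop :=
  ∀ x, ∀ z ∈ unitDisk, evB A (φ z) x = evB A z (T x)

/-- `S` represents `W_{u,φ}` -/
def IsS (u φ : ℂ → ℂ) (S : EE →L[ℂ] EE) : Prop :=
  ∀ c, ∀ z ∈ unitDisk, u z * ev2 (φ z) c = ev2 z (S c)

/-- polynomial part of `C_φ (a₁ f)` -/
def qpart {N : ℕ} (T : KK N →L[ℂ] KK N) (c : EE) : ℂ[X] := polyV N (T (c, 0)).2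

lemma qpart_add (T : KK N →L[ℂ] KK N) (c d : EE) : qpart T (c + d) = qpart T c + qpart T d := by
  have : ((c + d, 0) : KK N) = (c, 0) + (d, 0) := by simp
  rw [qpart, this, map_add, Prod.snd_add, map_add]; rfl

lemma qpart_smul (T : KK N →L[ℂ] KK N) (a : ℂ) (c : EE) : qpart T (a • c) = C a * qpart T c := by
  have : ((a • c, 0) : KK N) = a • (c, 0) := by simp
  rw [qpart, this, map_smul, Prod.smul_snd, map_smul, smul_eq_C_mul]; rfl

section
variable {φ : ℂ → ℂ} {xφ : KK N} {T : KK N →L[ℂ] KK N}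

lemma qpart_Sh (hA : GoodA A N) (hφ : MemBallHinf φ) (hmap : ∀ z ∈ unitDisk, φ z ∈ unitDisk)
    (hx : ∀ z ∈ unitDisk, φ z = evB A z xφ) (hT : IsT A N φ T) (c : EE) :
    A ∣ qpart T (Sh c) - polyV N xφ.2 * qpart T c := by
  obtain ⟨d, hd⟩ := hA.mul_phi hφ hx (T (c, 0)).1 (qpart T c)
  apply hA.good ((T (Sh c, 0)).1 - d)
  intro z hz
  have h1 := hT (Sh c, 0) z hz
  have h2 := hT (c, 0) z hz
  have h3 := hd z hz
  have e : ∀ c : EE, evB A z (T (c, 0)) = A.eval z * ev2 z (T (c, 0)).1 + (qpart T c).eval z :=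
    fun _ => rfl
  rw [← e c, ← h2] at h3
  rw [e] at h1
  have h4 : evB A (φ z) ((Sh c, 0) : KK N) = φ z * evB A (φ z) ((c, 0) : KK N) := by
    simp [evB, ev2_Sh (hmap z hz)]; ring
  rw [h4, h3] at h1
  rw [map_sub, eval_sub, mul_sub]
  linear_combination -h1

lemma qpart_aeval (hA : GoodA A N) (hφ : MemBallHinf φ) (hmap : ∀ z ∈ unitDisk, φ z ∈ unitDisk)
    (hx : ∀ z ∈ unitDisk, φ z = evB A z xφ) (hT : IsT A N φ T) (P : ℂ[X]) (c : EE) :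
    A ∣ qpart T (aeval Sh P c) - P.comp (polyV N xφ.2) * qpart T c := by
  induction P using Polynomial.induction_on' with
  | add p q hp hq =>
    have := dvd_add hp hq
    rw [map_add, add_apply, qpart_add, add_comp]
    convert this using 1
    ring
  | monomial n a =>
    have hn : ∀ n : ℕ, A ∣ qpart T ((Sh ^ n) c) - (polyV N xφ.2) ^ n * qpart T c := by
      intro n
      induction n with
      | zero => simp
      | succ n ih =>
        have h1 := qpart_Sh hA hφ hmap hx hT ((Sh ^ n) c)
        have := dvd_add h1 (ih.mul_left (polyV N xφ.2))
        rw [pow_succ', mul_apply_eq_comp]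
        convert this using 1
        ring
    rw [aeval_monomial, Algebra.algebraMap_eq_smul_one, smul_mul_assoc, one_mul, smul_apply,
      qpart_smul, monomial_comp]
    have := (hn n).mul_left (C a)
    convert this using 1
    ring

lemma taylor_dvd {q : ℂ[X]} {ξ : ℂ} {m : ℕ} :
    (X - C ξ) ^ m ∣ q ↔ ∀ k < m, (taylor ξ q).coeff k = 0 := by
  rw [← X_pow_dvd_iff]
  constructor
  · rintro ⟨r, rfl⟩
    rw [taylor_mul, taylor_pow]
    simp
  · rintro ⟨r, hr⟩
    refine ⟨taylor (-ξ) r, ?_⟩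
    have := congrArg (taylor (-ξ)) hr
    rw [taylor_taylor, taylor_mul, taylor_pow] at this
    simpa [sub_eq_add_neg] using this

lemma qpart_dvd (hA : GoodA A N) (hφ : MemBallHinf φ) (hmap : ∀ z ∈ unitDisk, φ z ∈ unitDisk)
    (hx : ∀ z ∈ unitDisk, φ z = evB A z xφ) (hT : IsT A N φ T) {ξ lam : ℂ} {m : ℕ}
    (hd : (X - C ξ) ^ m ∣ A) (hQ : (polyV N xφ.2).eval ξ = lam) (hl : ‖lam‖ = 1) (c : EE) :
    (X - C ξ) ^ m ∣ qpart T c := by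
  rw [taylor_dvd]
  intro k
  induction k using Nat.strong_induction_on generalizing c with
  | _ k ih =>
  intro hk
  let ℓ : VV N →ₗ[ℂ] ℂ := (lcoeff ℂ k) ∘ₗ (taylor ξ) ∘ₗ (polyV N)
  let L : EE →L[ℂ] ℂ := (LinearMap.toContinuousLinearMap ℓ) ∘L
    (ContinuousLinearMap.snd ℂ EE (VV N)) ∘L T ∘L (ContinuousLinearMap.inl ℂ EE (VV N))
  have hL : ∀ c, L c = (taylor ξ (qpart T c)).coeff k := fun c => rfl
  have h0 : L = 0 := by
    refine functional_zero L hl fun c => ?_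
    have h1 := taylor_dvd.1 (hd.trans (qpart_Sh hA hφ hmap hx hT c)) k hk
    rw [map_sub, coeff_sub, sub_eq_zero, taylor_mul, coeff_mul] at h1
    rw [hL, h1, Finset.sum_eq_single (0, k)]
    · rw [taylor_coeff_zero, hQ, hL]
    · rintro ⟨i, j⟩ hij hne
      rw [Finset.HasAntidiagonal.mem_antidiagonal] at hij
      simp only at hij ⊢
      have hj : j < k := by
        rcases Nat.eq_zero_or_pos i with h | h
        · exact absurd (by rw [Prod.mk.injEq]; omega) hne
        · omega
      rw [ih j hj c (by omega), mul_zero]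
    · simp
  rw [← hL, h0]; rfl

end

/-- representing operator on multiples of `a₁ P` -/
def IsG (A P : ℂ[X]) (N : ℕ) (φ : ℂ → ℂ) (G : EE →L[ℂ] KK N) : Prop :=
  ∀ c, ∀ z ∈ unitDisk, A.eval (φ z) * (P.eval (φ z) * ev2 (φ z) c) = evB A z (G c)

section
variable {φ : ℂ → ℂ} {xφ : KK N}

lemma isG_step (hA : GoodA A N) (hφ : MemBallHinf φ) (hmap : ∀ z ∈ unitDisk, φ z ∈ unitDisk)
    (hx : ∀ z ∈ unitDisk, φ z = evB A z xφ) {lam : ℂ} (hl : ‖lam‖ < 1) {P : ℂ[X]}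
    {G : EE →L[ℂ] KK N} (hG : IsG A ((X - C lam) * P) N φ G) :
    ∃ G' : EE →L[ℂ] KK N, IsG A P N φ G' ∧ (IsCompactOperator G → IsCompactOperator G') := by
  obtain ⟨D, δ, hD⟩ := shift_division hl
  obtain ⟨w, hw⟩ := hA.poly_phi hφ hx (A * P)
  refine ⟨G ∘L D + (ContinuousLinearMap.toSpanSingleton ℂ w) ∘L δ, ?_, ?_⟩
  · intro c z hz
    have h1 := hG (D c) z hz
    have h2 := hw z hz
    have h3 : ev2 (φ z) c = (φ z - lam) * ev2 (φ z) (D c) + δ c := by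
      conv_lhs => rw [hD c]
      simp [ev2_Sh (hmap z hz), ev2_eb (hmap z hz)]
      ring
    rw [add_apply, evB_add]
    simp only [ContinuousLinearMap.comp_apply, ContinuousLinearMap.toSpanSingleton_apply]
    rw [evB_smul, ← h1, ← h2, h3]
    simp
    ring
  · intro hc
    exact (hc.comp_clm D).add
      ((isCompactOperator_of_locallyCompactSpace_rng
        (ContinuousLinearMap.toSpanSingleton ℂ w)).comp_clm δ)

lemma isG_pow (hA : GoodA A N) (hφ : MemBallHinf φ) (hmap : ∀ z ∈ unitDisk, φ z ∈ unitDisk)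
    (hx : ∀ z ∈ unitDisk, φ z = evB A z xφ) {lam : ℂ} (hl : ‖lam‖ < 1) (m : ℕ) {P : ℂ[X]}
    {G : EE →L[ℂ] KK N} (hG : IsG A ((X - C lam) ^ m * P) N φ G) :
    ∃ G' : EE →L[ℂ] KK N, IsG A P N φ G' ∧ (IsCompactOperator G → IsCompactOperator G') := by
  induction m generalizing G with
  | zero => exact ⟨G, by simpa using hG, id⟩
  | succ m ih =>
    rw [pow_succ', mul_assoc] at hG
    obtain ⟨G1, h1, h2⟩ := isG_step hA hφ hmap hx hl hG
    obtain ⟨G2, h3, h4⟩ := ih h1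
    exact ⟨G2, h3, fun h => h4 (h2 h)⟩

lemma isG_prod (hA : GoodA A N) (hφ : MemBallHinf φ) (hmap : ∀ z ∈ unitDisk, φ z ∈ unitDisk)
    (hx : ∀ z ∈ unitDisk, φ z = evB A z xφ) {ι : Type*} (s : Finset ι) (lam : ι → ℂ)
    (hl : ∀ j ∈ s, ‖lam j‖ < 1) (m : ι → ℕ)
    {G : EE →L[ℂ] KK N} (hG : IsG A (∏ j ∈ s, (X - C (lam j)) ^ m j) N φ G) :
    ∃ G' : EE →L[ℂ] KK N, IsG A 1 N φ G' ∧ (IsCompactOperator G → IsCompactOperator G') := by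
  induction s using Finset.induction_on generalizing G with
  | empty => exact ⟨G, by simpa using hG, id⟩
  | insert j s hj ih =>
    rw [Finset.prod_insert hj] at hG
    obtain ⟨G1, h1, h2⟩ := isG_pow hA hφ hmap hx (hl j (by simp)) _ hG
    obtain ⟨G2, h3, h4⟩ := ih (fun i hi => hl i (by simp [hi])) h1
    exact ⟨G2, h3, fun h => h4 (h2 h)⟩

/-- from an operator on `a₁ H²` to an operator on `H(b)` -/
lemma isT_of_isG (hA : GoodA A N) (hφ : MemBallHinf φ)
    (hx : ∀ z ∈ unitDisk, φ z = evB A z xφ) {G : EE →L[ℂ] KK N} (hG : IsG A 1 N φ G) :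
    ∃ T : KK N →L[ℂ] KK N, IsT A N φ T ∧ (IsCompactOperator G → IsCompactOperator T) := by
  choose w hw using fun i : ℕ => hA.pow_phi hφ hx i
  let R0 : VV N →ₗ[ℂ] KK N :=
    { toFun := fun v => ∑ i : Fin N, v i • w i
      map_add' := fun v v' => by simp [add_smul, Finset.sum_add_distrib]
      map_smul' := fun a v => by simp [Finset.smul_sum, smul_smul] }
  let R : VV N →L[ℂ] KK N := LinearMap.toContinuousLinearMap R0
  have hR : ∀ (v : VV N), ∀ z ∈ unitDisk, (polyV N v).eval (φ z) = evB A z (R v) := by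
    intro v z hz
    have hs : ∀ s : Finset (Fin N), evB A z (∑ i ∈ s, v i • w i) = ∑ i ∈ s, v i * φ z ^ (i : ℕ) := by
      intro s
      induction s using Finset.induction_on with
      | empty => simp [evB]
      | insert j s hj ih =>
        rw [Finset.sum_insert hj, Finset.sum_insert hj, evB_add, ih, evB_smul, ← hw _ z hz]
    have : R v = ∑ i : Fin N, v i • w i := rfl
    rw [this, hs, polyV_apply, eval_finsetSum]
    simp
  refine ⟨G ∘L ContinuousLinearMap.fst ℂ EE (VV N) + R ∘L ContinuousLinearMap.snd ℂ EE (VV N),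
    ?_, ?_⟩
  · intro x z hz
    rw [add_apply, evB_add]
    simp only [ContinuousLinearMap.comp_apply, ContinuousLinearMap.coe_fst',
      ContinuousLinearMap.coe_snd']
    rw [← hG _ z hz, ← hR _ z hz, evB]
    simp
  · intro hc
    exact (hc.comp_clm _).add ((isCompactOperator_of_locallyCompactSpace_rng R).comp_clm _)

end

end

section

open Polynomial

variable {A : ℂ[X]} {N : ℕ}

lemma radial_value {ξ L : ℂ} (hξ : ‖ξ‖ = 1) (hd : (X - C ξ) ∣ A) {φ : ℂ → ℂ} {xφ : KK N}
    (hx : ∀ z ∈ unitDisk, φ z = evB A z xφ) (hL : NTLimit φ ξ L) :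
    (polyV N xφ.2).eval ξ = L := by
  obtain ⟨A', rfl⟩ := hd
  have h1 := radial_poly hξ A' (polyV N xφ.2) xφ.1
  have h0 : Tendsto (fun r : ℝ => (r : ℂ) * ξ) (nhdsWithin 1 (Set.Iio 1))
      (nhdsWithin ξ (stolzAngle ξ 2)) := by
    rw [tendsto_nhdsWithin_iff]
    refine ⟨radial_tendsto ξ, ?_⟩
    filter_upwards [Ioo_mem_left] with r hr
    refine ⟨radial_mem hξ hr, ?_⟩
    have e1 : (r : ℂ) * ξ - ξ = ((r - 1 : ℝ) : ℂ) * ξ := by push_cast; ring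
    rw [e1, norm_mul, norm_mul, hξ, Complex.norm_real, Complex.norm_real,
      Real.norm_of_nonneg hr.1.le, Real.norm_of_nonpos (by linarith [hr.2])]
    linarith [hr.2]
  have h2 := (hL 2 (by norm_num)).comp h0
  refine tendsto_nhds_unique (h1.congr' ?_) h2
  filter_upwards [Ioo_mem_left] with r hr
  rw [Function.comp_apply, hx _ (radial_mem hξ hr), evB]
  simp

lemma prod_dvd_aux {n : ℕ} (ξ : Fin n → ℂ) (hinj : Function.Injective ξ) (m : Fin n → ℕ)
    (Λ : Fin n → ℂ) (p : ℕ) (Q q : ℂ[X]) (h1 : ∀ j, Q.eval (ξ j) = Λ j)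
    (h2 : ∀ j : Fin n, (j : ℕ) < p → (X - C (ξ j)) ^ m j ∣ q) :
    (∏ j, (X - C (ξ j)) ^ m j) ∣
      (∏ j ∈ Finset.univ.filter fun j : Fin n => p ≤ (j : ℕ), (X - C (Λ j)) ^ m j).comp Q * q := by
  apply Finset.prod_dvd_of_coprime
  · intro i _ j _ hij
    apply IsCoprime.pow
    exact isCoprime_X_sub_C_of_isUnit_sub (by
      rw [isUnit_iff_ne_zero, sub_ne_zero]
      exact fun h => hij (hinj h))
  · intro j _
    by_cases hj : (j : ℕ) < p
    · exact (h2 j hj).mul_left _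
    · apply Dvd.dvd.mul_right
      rw [Polynomial.prod_comp]
      refine dvd_trans ?_ (Finset.dvd_prod_of_mem _ (a := j) (by simpa using hj))
      rw [pow_comp]
      apply pow_dvd_pow_of_dvd
      rw [dvd_iff_isRoot]
      simp [h1]

section
variable {φ u : ℂ → ℂ} {xφ : KK N} {T : KK N →L[ℂ] KK N} {B : ℂ[X]}

lemma isS_of_isT (hA : GoodA A N) (hφ : MemBallHinf φ) (hmap : ∀ z ∈ unitDisk, φ z ∈ unitDisk)
    (hx : ∀ z ∈ unitDisk, φ z = evB A z xφ) (hT : IsT A N φ T)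
    (hu : ∀ z ∈ unitDisk, u z = A.eval (φ z) * B.eval (φ z) / A.eval z)
    (hB : ∀ c, A ∣ B.comp (polyV N xφ.2) * qpart T c) :
    ∃ S : EE →L[ℂ] EE, IsS u φ S ∧ (IsCompactOperator T → IsCompactOperator S) ∧
      ∀ c, ‖S c‖ ≤ ‖T (aeval Sh B c, 0)‖ := by
  have h0 : ∀ c, (T (aeval Sh B c, 0)).2 = 0 := by
    intro c
    apply hA.zero_of_dvd
    have h := dvd_add (qpart_aeval hA hφ hmap hx hT B c) (hB c)
    rwa [sub_add_cancel] at h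
  refine ⟨(ContinuousLinearMap.fst ℂ EE (VV N)) ∘L T ∘L
    ((ContinuousLinearMap.inl ℂ EE (VV N)) ∘L (aeval Sh B)), ?_, ?_, ?_⟩
  · intro c z hz
    have h1 := hT (aeval Sh B c, 0) z hz
    have h2 : evB A z (T (aeval Sh B c, 0)) = A.eval z * ev2 z (T (aeval Sh B c, 0)).1 := by
      rw [evB, h0]; simp
    rw [h2, evB, ev2_aeval (hmap z hz)] at h1
    simp only [map_zero, eval_zero, add_zero] at h1
    rw [hu z hz, div_mul_eq_mul_div, div_eq_iff (hA.ne z hz), mul_assoc, h1, mul_comm]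
    rfl
  · intro hc
    exact (hc.comp_clm _).clm_comp (ContinuousLinearMap.fst ℂ EE (VV N))
  · intro c
    exact norm_fst_le (T (aeval Sh B c, 0))

lemma isT_of_isS {ι : Type*} (s : Finset ι) (lam : ι → ℂ)
    (hl : ∀ j ∈ s, ‖lam j‖ < 1) (m : ι → ℕ) (hBB : B = ∏ j ∈ s, (X - C (lam j)) ^ m j)
    (hA : GoodA A N) (hφ : MemBallHinf φ) (hmap : ∀ z ∈ unitDisk, φ z ∈ unitDisk)
    (hx : ∀ z ∈ unitDisk, φ z = evB A z xφ) {S : EE →L[ℂ] EE} (hS : IsS u φ S)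
    (hu : ∀ z ∈ unitDisk, u z = A.eval (φ z) * B.eval (φ z) / A.eval z) :
    ∃ T : KK N →L[ℂ] KK N, IsT A N φ T ∧ (IsCompactOperator S → IsCompactOperator T) ∧
      ∀ c, T (aeval Sh B c, 0) = (S c, 0) := by
  have key : ∀ c, ∀ z ∈ unitDisk, A.eval (φ z) * (B.eval (φ z) * ev2 (φ z) c) =
      evB A z ((S c, 0) : KK N) := by
    intro c z hz
    have h1 := hS c z hz
    have h2 := hA.ne z hz
    rw [evB, ← h1, hu z hz]
    simp
    field_simp
  have hG : IsG A B N φ ((ContinuousLinearMap.inl ℂ EE (VV N)) ∘L S) := key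
  rw [hBB] at hG
  obtain ⟨G', h1, h2⟩ := isG_prod hA hφ hmap hx s lam hl m hG
  obtain ⟨T, h3, h4⟩ := isT_of_isG hA hφ hx h1
  refine ⟨T, h3, fun h => h4 (h2 (h.clm_comp (ContinuousLinearMap.inl ℂ EE (VV N)))), fun c => ?_⟩
  apply hA.inj
  intro z hz
  rw [← h3 _ z hz, ← key c z hz, evB, ev2_aeval (hmap z hz)]
  simp
end

section HS

variable {F : Type*} [NormedAddCommGroup F] [NormedSpace ℂ F]

lemma summable_sq_add {F : Type*} [NormedAddCommGroup F] {a b : ℕ → F} (ha : Summable fun k => ‖a k‖ ^ 2)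
    (hb : Summable fun k => ‖b k‖ ^ 2) : Summable fun k => ‖a k + b k‖ ^ 2 := by
  refine Summable.of_nonneg_of_le (fun _ => by positivity) (fun k => ?_)
    ((ha.mul_left 2).add (hb.mul_left 2))
  have h := norm_add_le (a k) (b k)
  have h0 := norm_nonneg (a k + b k)
  nlinarith [sq_nonneg (‖a k‖ - ‖b k‖)]

lemma Sh_pow_eb (n k : ℕ) : (Sh ^ n) (eb k) = eb (k + n) := by
  induction n with
  | zero => simp
  | succ n ih => rw [pow_succ', mul_apply_eq_comp, ih, Sh_eb, add_assoc]

lemma summable_aeval (L : EE →L[ℂ] F) (h : Summable fun k => ‖L (eb k)‖ ^ 2) (P : ℂ[X]) :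
    Summable fun k => ‖L (aeval Sh P (eb k))‖ ^ 2 := by
  induction P using Polynomial.induction_on' with
  | add p q hp hq =>
    simp only [map_add, add_apply]
    exact summable_sq_add hp hq
  | monomial n a =>
    have h1 : Summable fun k => ‖L (eb (k + n))‖ ^ 2 := (summable_nat_add_iff n).2 h
    have := h1.mul_left (‖a‖ ^ 2)
    refine this.congr fun k => ?_
    rw [aeval_monomial, Algebra.algebraMap_eq_smul_one, smul_mul_assoc, one_mul, smul_apply,
      Sh_pow_eb, map_smul, norm_smul, mul_pow]

lemma summable_rec {x : ℕ → F} {lam : ℂ} (hl : ‖lam‖ < 1)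
    (h : Summable fun k => ‖x (k + 1) - lam • x k‖ ^ 2) : Summable fun k => ‖x k‖ ^ 2 := by
  set r := ‖lam‖ with hr
  have hr0 : 0 ≤ r := norm_nonneg _
  set Y := ∑' k, ‖x (k + 1) - lam • x k‖ ^ 2 with hY
  have h1 : ∀ k, ‖x (k + 1)‖ ^ 2 ≤ r * ‖x k‖ ^ 2 + ‖x (k + 1) - lam • x k‖ ^ 2 / (1 - r) := by
    intro k
    have h2 : ‖x (k + 1)‖ ≤ r * ‖x k‖ + ‖x (k + 1) - lam • x k‖ := by
      have := norm_add_le (lam • x k) (x (k + 1) - lam • x k)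
      rw [add_sub_cancel, norm_smul] at this
      exact this
    have h3 : ‖x (k + 1)‖ ^ 2 ≤ (r * ‖x k‖ + ‖x (k + 1) - lam • x k‖) ^ 2 :=
      pow_le_pow_left₀ (norm_nonneg _) h2 2
    refine h3.trans ?_
    generalize ‖x k‖ = s
    generalize ‖x (k + 1) - lam • x k‖ = t
    have h4 : 0 < 1 - r := by linarith
    rw [← sub_nonneg]
    have : r * s ^ 2 + t ^ 2 / (1 - r) - (r * s + t) ^ 2 = r * ((1 - r) * s - t) ^ 2 / (1 - r) := by
      field_simp
      ring
    rw [this]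
    positivity
  have h4 : 0 < 1 - r := by linarith
  apply summable_of_sum_range_le (c := (‖x 0‖ ^ 2 + Y / (1 - r)) / (1 - r))
    (fun _ => by positivity)
  intro n
  rw [le_div_iff₀ h4]
  have h5 : ∑ k ∈ Finset.range n, ‖x k‖ ^ 2 ≤ ∑ k ∈ Finset.range (n + 1), ‖x k‖ ^ 2 := by
    rw [Finset.sum_range_succ]
    have : 0 ≤ ‖x n‖ ^ 2 := by positivity
    linarith
  rw [Finset.sum_range_succ'] at h5
  have h6 : ∑ k ∈ Finset.range n, ‖x (k + 1)‖ ^ 2 ≤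
      r * ∑ k ∈ Finset.range n, ‖x k‖ ^ 2 + Y / (1 - r) := by
    refine (Finset.sum_le_sum fun k _ => h1 k).trans ?_
    rw [Finset.sum_add_distrib, ← Finset.mul_sum, ← Finset.sum_div]
    have := h.sum_le_tsum (Finset.range n) (fun _ _ => by positivity)
    gcongr
  linarith

lemma summable_desc (L : EE →L[ℂ] F) {lam : ℂ} (hl : ‖lam‖ < 1) (P : ℂ[X])
    (h : Summable fun k => ‖L (aeval Sh ((X - C lam) * P) (eb k))‖ ^ 2) :
    Summable fun k => ‖L (aeval Sh P (eb k))‖ ^ 2 := by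
  refine summable_rec hl (h.congr fun k => ?_)
  rw [mul_comm, map_mul, mul_apply_eq_comp, map_sub, aeval_X, aeval_C,
    Algebra.algebraMap_eq_smul_one, sub_apply, smul_apply, one_apply_eq_self, Sh_eb,
    map_sub, map_smul, map_sub, map_smul]

lemma summable_desc_pow (L : EE →L[ℂ] F) {lam : ℂ} (hl : ‖lam‖ < 1) (m : ℕ) (P : ℂ[X])
    (h : Summable fun k => ‖L (aeval Sh ((X - C lam) ^ m * P) (eb k))‖ ^ 2) :
    Summable fun k => ‖L (aeval Sh P (eb k))‖ ^ 2 := by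
  induction m with
  | zero => simpa using h
  | succ m ih =>
    apply ih
    rw [pow_succ', mul_assoc] at h
    exact summable_desc L hl _ h

lemma summable_desc_prod (L : EE →L[ℂ] F) {ι : Type*} (s : Finset ι) (lam : ι → ℂ)
    (hl : ∀ j ∈ s, ‖lam j‖ < 1) (m : ι → ℕ)
    (h : Summable fun k => ‖L (aeval Sh (∏ j ∈ s, (X - C (lam j)) ^ m j) (eb k))‖ ^ 2) :
    Summable fun k => ‖L (eb k)‖ ^ 2 := by
  induction s using Finset.induction_on with
  | empty => simpa using h
  | insert j s hj ih =>
    rw [Finset.prod_insert hj] at h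
    exact ih (fun i hi => hl i (by simp [hi])) (summable_desc_pow L (hl j (by simp)) _ _ h)

end HS

end

section

open Polynomial

lemma compact_iff_seq {E F : Type*} [NormedAddCommGroup E] [NormedSpace ℂ E]
    [NormedAddCommGroup F] [NormedSpace ℂ F] (T : E →L[ℂ] F) :
    IsCompactOperator T ↔ ∀ x : ℕ → E, (∀ k, ‖x k‖ ≤ 1) →
      ∃ (κ : ℕ → ℕ) (y : F), StrictMono κ ∧ Tendsto (fun i => T (x (κ i))) atTop (nhds y) := by
  have key := isCompactOperator_iff_isCompact_closure_image_closedBall (T : E →ₗ[ℂ] F) one_pos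
  constructor
  · intro h x hx
    have h1 := key.1 h
    obtain ⟨y, -, κ, hκ, hy⟩ := h1.tendsto_subseq (x := fun k => T (x k)) (fun k =>
      subset_closure ⟨x k, by simpa using hx k, rfl⟩)
    exact ⟨κ, y, hκ, hy⟩
  · intro h
    refine key.2 ?_
    rw [isCompact_iff_isSeqCompact]
    intro w hw
    have h2 : ∀ k : ℕ, ∃ x : E, ‖x‖ ≤ 1 ∧ dist (w k) (T x) < 1 / ((k : ℝ) + 1) := by
      intro k
      obtain ⟨_, ⟨x, hx, rfl⟩, hd⟩ := Metric.mem_closure_iff.1 (hw k) (1 / ((k : ℝ) + 1))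
        (by positivity)
      exact ⟨x, by simpa using hx, hd⟩
    choose x hx hd using h2
    obtain ⟨κ, y, hκ, hy⟩ := h x hx
    have h3 : Tendsto (fun i => dist (w (κ i)) (T (x (κ i)))) atTop (nhds 0) := by
      have h4 := (tendsto_one_div_add_atTop_nhds_zero_nat (𝕜 := ℝ)).comp hκ.tendsto_atTop
      exact squeeze_zero (fun _ => dist_nonneg) (fun i => (hd (κ i)).le) h4
    have h5 : Tendsto (w ∘ κ) atTop (nhds y) := by
      rw [tendsto_iff_dist_tendsto_zero] at hy ⊢
      refine squeeze_zero (fun _ => dist_nonneg)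
        (fun i => dist_triangle (w (κ i)) (T (x (κ i))) y) ?_
      simpa using h3.add hy
    exact ⟨y, isClosed_closure.mem_of_tendsto h5 (Eventually.of_forall fun i => hw _), κ, hκ, h5⟩

/-- a normed space modelling a space of functions on the disk -/
structure FModel (E : Type*) [NormedAddCommGroup E] [NormedSpace ℂ E] (ev : ℂ → E →ₗ[ℂ] ℂ)
    (Mem : (ℂ → ℂ) → Prop) (Nsq : (ℂ → ℂ) → ℝ) : Prop where
  mem : ∀ f x, (∀ z ∈ unitDisk, f z = ev z x) → Mem f
  ex : ∀ f, Mem f → ∃ x, ∀ z ∈ unitDisk, f z = ev z x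
  lo : ∀ f x, (∀ z ∈ unitDisk, f z = ev z x) → ‖x‖ ^ 2 ≤ Nsq f
  hi : ∀ f x, (∀ z ∈ unitDisk, f z = ev z x) → Nsq f ≤ 2 * ‖x‖ ^ 2
  inj : ∀ x y, (∀ z ∈ unitDisk, ev z x = ev z y) → x = y

/-- `T` represents the weighted composition operator -/
def IsR {E : Type*} [NormedAddCommGroup E] [NormedSpace ℂ E] (ev : ℂ → E →ₗ[ℂ] ℂ)
    (u φ : ℂ → ℂ) (T : E →L[ℂ] E) : Prop :=
  ∀ x, ∀ z ∈ unitDisk, u z * ev (φ z) x = ev z (T x)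

section
variable {E : Type*} [NormedAddCommGroup E] [NormedSpace ℂ E] {ev : ℂ → E →ₗ[ℂ] ℂ}
    {Mem : (ℂ → ℂ) → Prop} {Nsq : (ℂ → ℂ) → ℝ} {u φ : ℂ → ℂ}

lemma FModel.bdd_iff (M : FModel E ev Mem Nsq) (hmap : ∀ z ∈ unitDisk, φ z ∈ unitDisk) :
    ((∀ f, Mem f → Mem fun z => u z * f (φ z)) ∧
      ∃ C : ℝ, ∀ f, Mem f → Nsq (fun z => u z * f (φ z)) ≤ C * Nsq f) ↔
    ∃ T : E →L[ℂ] E, IsR ev u φ T := by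
  constructor
  · rintro ⟨h1, C, hC⟩
    have hm : ∀ x : E, Mem fun z => ev z x := fun x => M.mem _ x fun _ _ => rfl
    have h2 : ∀ x : E, ∃ y : E, ∀ z ∈ unitDisk, u z * ev (φ z) x = ev z y :=
      fun x => M.ex _ (h1 _ (hm x))
    choose t ht using h2
    let L : E →ₗ[ℂ] E :=
      { toFun := t
        map_add' := fun x y => M.inj _ _ fun z hz => by
          rw [← ht _ z hz, map_add, map_add, ← ht _ z hz, ← ht _ z hz, mul_add]
        map_smul' := fun a x => M.inj _ _ fun z hz => by
          rw [← ht _ z hz, map_smul, map_smul, RingHom.id_apply, ← ht _ z hz, smul_eq_mul,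
            smul_eq_mul]
          ring }
    refine ⟨L.mkContinuous (Real.sqrt (|C| * 2)) fun x => ?_, fun x z hz => ht x z hz⟩
    have h3 := M.lo _ _ (ht x)
    have h4 := hC _ (hm x)
    have h5 := M.hi (fun z => ev z x) x fun _ _ => rfl
    have h6 := M.lo (fun z => ev z x) x fun _ _ => rfl
    have h7 : ‖t x‖ ^ 2 ≤ |C| * 2 * ‖x‖ ^ 2 := by
      have h8 : C * Nsq (fun z => ev z x) ≤ |C| * (2 * ‖x‖ ^ 2) :=
        mul_le_mul (le_abs_self C) h5 (le_trans (by positivity) h6) (abs_nonneg C)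
      linarith
    have h9 : ‖t x‖ ^ 2 ≤ (Real.sqrt (|C| * 2) * ‖x‖) ^ 2 := by
      rw [mul_pow, Real.sq_sqrt (by positivity)]; exact h7
    exact (pow_le_pow_iff_left₀ (norm_nonneg _) (by positivity) two_ne_zero).1 h9
  · rintro ⟨T, hT⟩
    refine ⟨fun f hf => ?_, 2 * ‖T‖ ^ 2, fun f hf => ?_⟩
    · obtain ⟨x, hx⟩ := M.ex f hf
      exact M.mem _ (T x) fun z hz => by rw [hx _ (hmap z hz), hT x z hz]
    · obtain ⟨x, hx⟩ := M.ex f hf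
      have h1 := M.hi (fun z => u z * f (φ z)) (T x) fun z hz => by
        rw [hx _ (hmap z hz), hT x z hz]
      have h2 := M.lo f x hx
      have h3 : ‖T x‖ ^ 2 ≤ ‖T‖ ^ 2 * ‖x‖ ^ 2 := by
        rw [← mul_pow]
        exact pow_le_pow_left₀ (norm_nonneg _) (T.le_opNorm x) 2
      have h4 : ‖T‖ ^ 2 * ‖x‖ ^ 2 ≤ ‖T‖ ^ 2 * Nsq f := by gcongr
      linarith

lemma FModel.compact_iff (M : FModel E ev Mem Nsq) (hmap : ∀ z ∈ unitDisk, φ z ∈ unitDisk)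
    {T : E →L[ℂ] E} (hT : IsR ev u φ T) :
    (∀ f : ℕ → ℂ → ℂ, (∀ k, Mem (f k) ∧ Nsq (f k) ≤ 1) →
      ∃ (κ : ℕ → ℕ) (g : ℂ → ℂ), StrictMono κ ∧ Mem g ∧
        Tendsto (fun i => Nsq fun z => u z * f (κ i) (φ z) - g z) atTop (nhds 0)) ↔
    IsCompactOperator T := by
  rw [compact_iff_seq]
  constructor
  · intro h x hx
    obtain ⟨κ, g, hκ, hg, ht⟩ := h (fun k z => ev z ((1 / 2 : ℂ) • x k)) (fun k => by
      refine ⟨M.mem _ _ fun _ _ => rfl, ?_⟩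
      have h1 := M.hi (fun z => ev z ((1 / 2 : ℂ) • x k)) _ fun _ _ => rfl
      rw [norm_smul] at h1
      have h2 : ‖(1 / 2 : ℂ)‖ = 1 / 2 := by norm_num
      rw [h2] at h1
      have := hx k
      have := norm_nonneg (x k)
      nlinarith)
    obtain ⟨y, hy⟩ := M.ex g hg
    refine ⟨κ, (2 : ℂ) • y, hκ, ?_⟩
    have h3 : Tendsto (fun i => ‖T ((1 / 2 : ℂ) • x (κ i)) - y‖ ^ 2) atTop (nhds 0) := by
      refine squeeze_zero (fun _ => by positivity) (fun i => ?_) ht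
      apply M.lo
      intro z hz
      rw [map_sub, ← hT _ z hz, hy z hz]
    have h4 : Tendsto (fun i => ‖T ((1 / 2 : ℂ) • x (κ i)) - y‖) atTop (nhds 0) := by
      have := h3.sqrt
      simpa [Real.sqrt_sq] using this
    have h5 := (tendsto_iff_norm_sub_tendsto_zero.2 h4).const_smul (2 : ℂ)
    refine h5.congr fun i => ?_
    rw [map_smul, smul_smul]
    norm_num
  · intro h f hf
    choose x hx using fun k => M.ex (f k) (hf k).1
    obtain ⟨κ, y, hκ, hy⟩ := h x (fun k => by
      have h1 := M.lo _ _ (hx k)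
      have h2 := (hf k).2
      have h3 := norm_nonneg (x k)
      nlinarith)
    refine ⟨κ, fun z => ev z y, hκ, M.mem _ _ fun _ _ => rfl, ?_⟩
    have h4 := ((tendsto_iff_norm_sub_tendsto_zero.1 hy).pow 2).const_mul 2
    have hr : ∀ i, ∀ z ∈ unitDisk, u z * f (κ i) (φ z) - ev z y = ev z (T (x (κ i)) - y) := by
      intro i z hz
      rw [hx _ _ (hmap z hz), hT _ z hz, map_sub]
    refine squeeze_zero (fun i => ?_) (fun i => M.hi _ _ (hr i)) (by simpa using h4)
    exact le_trans (by positivity) (M.lo _ _ (hr i))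

lemma FModel.hs_iff (M : FModel E ev Mem Nsq) {T : E →L[ℂ] E} (hT : IsR ev u φ T) (e : ℕ → E)
    (F : ℕ → ℂ → ℂ) (hF : ∀ k, ∀ z ∈ unitDisk, F k z = u z * ev (φ z) (e k)) :
    (Summable fun k => Nsq (F k)) ↔ Summable fun k => ‖T (e k)‖ ^ 2 := by
  have h : ∀ k, ∀ z ∈ unitDisk, F k z = ev z (T (e k)) := fun k z hz => by
    rw [hF k z hz, hT _ z hz]
  constructor
  · intro hs
    exact Summable.of_nonneg_of_le (fun _ => by positivity) (fun k => M.lo _ _ (h k)) hs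
  · intro hs
    exact Summable.of_nonneg_of_le (fun k => le_trans (by positivity) (M.lo _ _ (h k)))
      (fun k => M.hi _ _ (h k)) (hs.mul_left 2)

end

lemma h2_model : FModel EE (fun z => (ev2 z : EE →ₗ[ℂ] ℂ)) MemH2 h2NormSq where
  mem f x h := (memH2_of_ev2 h).1
  ex f h := memH2_exists h
  lo f x h := (memH2_of_ev2 h).2.ge
  hi f x h := by
    have h1 := (memH2_of_ev2 h).2
    have : 0 ≤ ‖x‖ ^ 2 := by positivity
    linarith
  inj x y h := ev2_inj h

/-- the polynomial `a₁` -/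
def apoly {n : ℕ} (ξ : Fin n → ℂ) (m : Fin n → ℕ) : ℂ[X] := ∏ j, (X - C (ξ j)) ^ m j

lemma apoly_eval {n : ℕ} (ξ : Fin n → ℂ) (m : Fin n → ℕ) (z : ℂ) :
    a1fun ξ m z = (apoly ξ m).eval z := by
  simp [a1fun, apoly, eval_prod]

lemma apoly_good {n : ℕ} (ξ : Fin n → ℂ) (m : Fin n → ℕ) (hξ : ∀ j, ‖ξ j‖ = 1) :
    GoodA (apoly ξ m) (∑ j, m j) where
  good := GoodP.prod Finset.univ ξ hξ m
  monic := monic_prod_of_monic _ _ fun j _ => (monic_X_sub_C _).pow _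
  deg := by
    rw [apoly, natDegree_prod_of_monic _ _ fun j _ => (monic_X_sub_C _).pow _]
    simp
  ne := by
    intro z hz
    rw [← apoly_eval, a1fun, Finset.prod_ne_zero_iff]
    intro j _
    apply pow_ne_zero
    rw [sub_ne_zero]
    rintro rfl
    rw [mem_disk, hξ] at hz
    exact lt_irrefl _ hz

def evBL (A : ℂ[X]) (N : ℕ) (z : ℂ) : KK N →ₗ[ℂ] ℂ where
  toFun x := evB A z x
  map_add' x y := evB_add A z x y
  map_smul' a x := evB_smul A z a x

section
variable {n : ℕ} {ξ : Fin n → ℂ} {m : Fin n → ℕ}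

lemma memHb_of (f : ℂ → ℂ) (x : KK (∑ j, m j))
    (h : ∀ z ∈ unitDisk, f z = evB (apoly ξ m) z x) : MemHb ξ m f := by
  refine ⟨(fun z => ev2 z x.1, polyV _ x.2), (memH2_of_ev2 fun _ _ => rfl).1, polyV_degree _, ?_⟩
  intro z hz
  rw [h z hz, evB, apoly_eval]

lemma decomp_rep {f g : ℂ → ℂ} {q : ℂ[X]} (h : HbDecompOf ξ m f g q) :
    ∃ x : KK (∑ j, m j), (∀ z ∈ unitDisk, f z = evB (apoly ξ m) z x) ∧
      h2NormSq g = ‖x.1‖ ^ 2 ∧ h2NormSq (fun z => q.eval z) = ‖x.2‖ ^ 2 := by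
  obtain ⟨h1, h2, h3⟩ := h
  obtain ⟨c, hc⟩ := memH2_exists h1
  obtain ⟨v, rfl⟩ := polyV_surj h2
  refine ⟨(c, v), fun z hz => ?_, (memH2_of_ev2 hc).2, polyV_h2 v⟩
  rw [h3 z hz, evB, apoly_eval, hc z hz]

lemma hbNormSq_eq (hξ : ∀ j, ‖ξ j‖ = 1) (f : ℂ → ℂ) (x : KK (∑ j, m j))
    (h : ∀ z ∈ unitDisk, f z = evB (apoly ξ m) z x) :
    hbNormSq ξ m f = ‖x.1‖ ^ 2 + ‖x.2‖ ^ 2 := by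
  have hm := memHb_of f x h
  have hd : hbDecomp ξ m f = hm.choose := by rw [hbDecomp, dif_pos hm]
  obtain ⟨y, h1, h2, h3⟩ := decomp_rep hm.choose_spec
  have hxy : x = y := (apoly_good ξ m hξ).inj fun z hz => by rw [← h z hz, ← h1 z hz]
  rw [hbNormSq, hd, h2, h3, hxy]

lemma hb_model (hξ : ∀ j, ‖ξ j‖ = 1) :
    FModel (KK (∑ j, m j)) (evBL (apoly ξ m) (∑ j, m j)) (MemHb ξ m) (hbNormSq ξ m) where
  mem f x h := memHb_of f x h
  ex f h := by
    obtain ⟨gq, hgq⟩ := h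
    obtain ⟨x, hx, -⟩ := decomp_rep hgq
    exact ⟨x, hx⟩
  lo f x h := by
    rw [hbNormSq_eq hξ f x h, Prod.norm_def]
    rcases max_cases ‖x.1‖ ‖x.2‖ with ⟨h1, -⟩ | ⟨h1, -⟩ <;> rw [h1] <;>
      nlinarith [sq_nonneg ‖x.1‖, sq_nonneg ‖x.2‖]
  hi f x h := by
    rw [hbNormSq_eq hξ f x h]
    have h1 : ‖x.1‖ ^ 2 ≤ ‖x‖ ^ 2 := pow_le_pow_left₀ (norm_nonneg _) (norm_fst_le x) 2
    have h2 : ‖x.2‖ ^ 2 ≤ ‖x‖ ^ 2 := pow_le_pow_left₀ (norm_nonneg _) (norm_snd_le x) 2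
    linarith
  inj x y h := (apoly_good ξ m hξ).inj h

end

end

/-- Theorem 5.2. `C_φ` is compact (resp. Hilbert–Schmidt) on `H(b)` if
and only if `W_{u,φ}` is compact (resp. Hilbert–Schmidt) on `H²`. -/
theorem comp_compact_HS_iff_weighted
    (b a : ℂ → ℂ) (n : ℕ) (ξ : Fin n → ℂ) (m : Fin n → ℕ)
    (hset : RationalSetting b a n ξ m)
    (φ : ℂ → ℂ) (hφb : MemHb ξ m φ) (hφball : MemBallHinf φ)
    (hφmap : ∀ z ∈ unitDisk, φ z ∈ unitDisk)
    (Λ : Fin n → ℂ) (hΛ : ∀ j, NTLimit φ (ξ j) (Λ j))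
    (p : ℕ) (hp : p ≤ n)
    (hΛcirc : ∀ j : Fin n, (j : ℕ) < p → ∃ i, Λ j = ξ i)
    (hΛdisk : ∀ j : Fin n, p ≤ (j : ℕ) → Λ j ∈ unitDisk) :
    (CompCompactHb ξ m φ ↔ WCompCompactH2 (ufun p ξ m Λ φ) φ) ∧
    (CompHSHb ξ m φ ↔ WCompHSH2 (ufun p ξ m Λ φ) φ) := by
  have hξ : ∀ j, ‖ξ j‖ = 1 := fun j => by
    have := hset.zeros_mem j
    simpa [unitCircle] using this
  have hA := apoly_good ξ m hξ
  have M1 := hb_model (m := m) hξ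
  have M2 := h2_model
  set A := apoly ξ m with hAdef
  set N := ∑ j, m j with hN
  set u := ufun p ξ m Λ φ with hudef
  obtain ⟨xφ, hx⟩ : ∃ x : KK N, ∀ z ∈ unitDisk, φ z = evB A z x := M1.ex φ hφb
  set B : Polynomial ℂ := ∏ j ∈ Finset.univ.filter fun j : Fin n => p ≤ (j : ℕ),
    (Polynomial.X - Polynomial.C (Λ j)) ^ m j with hB
  have hu : ∀ z ∈ unitDisk, u z = A.eval (φ z) * B.eval (φ z) / A.eval z := by
    intro z _
    rw [hudef, ufun, apoly_eval, apoly_eval, hB, Polynomial.eval_prod]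
    simp
    rfl
  have hl : ∀ j ∈ Finset.univ.filter fun j : Fin n => p ≤ (j : ℕ), ‖Λ j‖ < 1 := by
    intro j hj
    exact mem_disk.1 (hΛdisk j (by simpa using hj))
  have hdvd : ∀ j, (Polynomial.X - Polynomial.C (ξ j)) ^ m j ∣ A := fun j =>
    Finset.dvd_prod_of_mem (fun j => (Polynomial.X - Polynomial.C (ξ j)) ^ m j) (Finset.mem_univ j)
  have hQ : ∀ j, (polyV N xφ.2).eval (ξ j) = Λ j := fun j =>
    radial_value (hξ j) ((dvd_pow_self _ (hset.mult_pos j).ne').trans (hdvd j)) hx (hΛ j)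
  have dirA : ∀ T, IsT A N φ T → ∃ S : EE →L[ℂ] EE, IsS u φ S ∧
      (IsCompactOperator T → IsCompactOperator S) ∧
      ∀ c, ‖S c‖ ≤ ‖T (Polynomial.aeval Sh B c, 0)‖ := by
    intro T hT
    apply isS_of_isT hA hφball hφmap hx hT hu
    intro c
    apply prod_dvd_aux ξ hset.zeros_inj m Λ p _ _ hQ
    intro j hj
    obtain ⟨i, hi⟩ := hΛcirc j hj
    exact qpart_dvd hA hφball hφmap hx hT (hdvd j) (hQ j) (by rw [hi]; exact hξ i) c
  have dirB : ∀ S, IsS u φ S → ∃ T : KK N →L[ℂ] KK N, IsT A N φ T ∧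
      (IsCompactOperator S → IsCompactOperator T) ∧
      ∀ c, T (Polynomial.aeval Sh B c, 0) = (S c, 0) := by
    intro S hS
    exact isT_of_isS _ Λ hl m hB hA hφball hφmap hx hS hu
  have tR : ∀ T, IsT A N φ T ↔ IsR (evBL A N) (fun _ => 1) φ T := by
    intro T
    simp only [IsR, one_mul]
    rfl
  have b1 : CompBddHb ξ m φ ↔ ∃ T, IsT A N φ T := by
    have := M1.bdd_iff (u := fun _ => 1) hφmap
    simp only [one_mul] at this
    simp only [tR]
    exact this
  have b2 : WCompBddH2 u φ ↔ ∃ S, IsS u φ S := M2.bdd_iff hφmap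
  have c1 : ∀ T, IsT A N φ T → ((∀ f : ℕ → ℂ → ℂ,
      (∀ k, MemHb ξ m (f k) ∧ hbNormSq ξ m (f k) ≤ 1) →
      ∃ (κ : ℕ → ℕ) (g : ℂ → ℂ), StrictMono κ ∧ MemHb ξ m g ∧
      Tendsto (fun i => hbNormSq ξ m fun z => f (κ i) (φ z) - g z) atTop (nhds 0)) ↔
      IsCompactOperator T) := by
    intro T hT
    have := M1.compact_iff (u := fun _ => 1) hφmap ((tR T).1 hT)
    simpa only [one_mul] using this
  have c2 : ∀ S, IsS u φ S → (_ ↔ IsCompactOperator S) := fun S hS =>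
    M2.compact_iff (u := u) hφmap hS
  have s1 : ∀ T, IsT A N φ T → ((Summable fun k : ℕ => hbNormSq ξ m fun z =>
      a1fun ξ m (φ z) * φ z ^ k) ↔ Summable fun k => ‖T (eb k, 0)‖ ^ 2) := by
    intro T hT
    refine M1.hs_iff ((tR T).1 hT) (fun k => (eb k, 0)) _ ?_
    intro k z hz
    have : evBL A N (φ z) (eb k, 0) = A.eval (φ z) * φ z ^ k := by
      show evB A (φ z) (eb k, 0) = _
      rw [evB, ev2_eb (hφmap z hz)]
      simp
    simp only [this, one_mul, apoly_eval]
    rfl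
  have s2 : ∀ S, IsS u φ S → ((Summable fun k : ℕ => h2NormSq fun z => u z * φ z ^ k) ↔
      Summable fun k => ‖S (eb k)‖ ^ 2) := by
    intro S hS
    refine M2.hs_iff hS eb _ ?_
    intro k z hz
    have : ev2 (φ z) (eb k) = φ z ^ k := ev2_eb (hφmap z hz) k
    simp [this]
  refine ⟨⟨?_, ?_⟩, ⟨?_, ?_⟩⟩
  · rintro ⟨h1, h2⟩
    obtain ⟨T, hT⟩ := b1.1 h1
    obtain ⟨S, hS, h3, -⟩ := dirA T hT
    exact ⟨b2.2 ⟨S, hS⟩, (c2 S hS).2 (h3 ((c1 T hT).1 h2))⟩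
  · rintro ⟨h1, h2⟩
    obtain ⟨S, hS⟩ := b2.1 h1
    obtain ⟨T, hT, h3, -⟩ := dirB S hS
    exact ⟨b1.2 ⟨T, hT⟩, (c1 T hT).2 (h3 ((c2 S hS).1 h2))⟩
  · rintro ⟨h1, h2⟩
    obtain ⟨T, hT⟩ := b1.1 h1
    obtain ⟨S, hS, -, h3⟩ := dirA T hT
    refine ⟨b2.2 ⟨S, hS⟩, (s2 S hS).2 ?_⟩
    have h4 := summable_aeval (T ∘L ContinuousLinearMap.inl ℂ EE (VV N)) ((s1 T hT).1 h2) B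
    exact Summable.of_nonneg_of_le (fun _ => by positivity)
      (fun k => pow_le_pow_left₀ (norm_nonneg _) (h3 (eb k)) 2) h4
  · rintro ⟨h1, h2⟩
    obtain ⟨S, hS⟩ := b2.1 h1
    obtain ⟨T, hT, -, h3⟩ := dirB S hS
    refine ⟨b1.2 ⟨T, hT⟩, (s1 T hT).2 ?_⟩
    apply summable_desc_prod (T ∘L ContinuousLinearMap.inl ℂ EE (VV N)) _ Λ hl m
    refine ((s2 S hS).1 h2).congr fun k => ?_
    have h5 : (T ∘L ContinuousLinearMap.inl ℂ EE (VV N)) (Polynomial.aeval Sh B (eb k)) =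
      (S (eb k), 0) := h3 (eb k)
    rw [h5, Prod.norm_def]
    simp

end
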